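/- arXiv:2303.18148 — 2 statements merged into one kernel-verified Lean document; each statement's English description precedes it below -/
import Mathlib

section
/- Let Σ(A,B,C,G) be a system node with finite-dimensional input space U and finite-dimensional output space Y. Then Σ(A,B,C,G) is C^∞-BIBO stable if and only if it is L^∞-BIBO stable. -/
/-- A bundled complex Banach space (declared before `open MeasureTheory`, whose
notations interfere with instance-binder fields in structures). -/
structure CplxBanach where
  carrier : Type
  [nacg : NormedAddCommGroup carrier]
  [nsp : NormedSpace ℂ carrier]
  [cs : CompleteSpace carrier]

attribute [instance] CplxBanach.nacg CplxBanach.nsp CplxBanach.cs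

/-- A bundled complex Hilbert space. -/
structure CplxHilbert where
  carrier : Type
  [nacg : NormedAddCommGroup carrier]
  [ips : InnerProductSpace ℂ carrier]
  [cs : CompleteSpace carrier]

attribute [instance] CplxHilbert.nacg CplxHilbert.ips CplxHilbert.cs

open MeasureTheory Set
open scoped ENNReal NNReal Topology

noncomputable section

/-- A strongly continuous semigroup of bounded linear operators on a complex Banach space. -/
structure C0Semigroup (X : Type*) [NormedAddCommGroup X] [NormedSpace ℂ X] where
  T : ℝ → X →L[ℂ] X
  map_zero : T 0 = ContinuousLinearMap.id ℂ X
  map_add : ∀ s t : ℝ, 0 ≤ s → 0 ≤ t → T (s + t) = (T s).comp (T t)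
  strongly_continuous : ∀ x : X, ContinuousOn (fun t => T t x) (Set.Ici 0)

namespace C0Semigroup

variable {X : Type*} [NormedAddCommGroup X] [NormedSpace ℂ X]

/-- The growth bound `ω(T)` of a strongly continuous semigroup. -/
def growthBound (S : C0Semigroup X) : ℝ :=
  sInf {w : ℝ | ∃ M : ℝ, ∀ t : ℝ, 0 ≤ t → ‖S.T t‖ ≤ M * Real.exp (w * t)}

/-- Exponential stability of a strongly continuous semigroup. -/
def ExpStable (S : C0Semigroup X) : Prop :=
  ∃ ε : ℝ, 0 < ε ∧ ∃ M : ℝ, ∀ t : ℝ, 0 ≤ t → ‖S.T t‖ ≤ M * Real.exp (-ε * t)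

/-- The semigroup is analytic: it extends analytically to an open sector around the
positive real axis, the extension satisfying the semigroup property on the sector. -/
def IsAnalytic (S : C0Semigroup X) : Prop :=
  ∃ θ : ℝ, θ ∈ Set.Ioo 0 (Real.pi / 2) ∧ ∃ F : ℂ → X →L[ℂ] X,
    DifferentiableOn ℂ F {z : ℂ | z ≠ 0 ∧ |Complex.arg z| < θ} ∧
    (∀ t : ℝ, 0 < t → F t = S.T t) ∧
    (∀ z w : ℂ, (z ≠ 0 ∧ |Complex.arg z| < θ) → (w ≠ 0 ∧ |Complex.arg w| < θ) →
      F (z + w) = (F z).comp (F w))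

/-- The fractional power `(-A)^{-γ}` of the negative generator of an exponentially
stable semigroup, defined through the standard integral formula
`(-A)^{-γ} = Γ(γ)⁻¹ ∫_0^∞ t^{γ-1} T(t) dt` (and the identity for `γ = 0`). -/
def negAPow (S : C0Semigroup X) (γ : ℝ) : X →L[ℂ] X :=
  if γ = 0 then ContinuousLinearMap.id ℂ X
  else (Real.Gamma γ)⁻¹ • ∫ t in Set.Ioi (0:ℝ), t ^ (γ - 1) • S.T t

end C0Semigroup

/-- A system node `Σ(A,B,C,G)` on the Banach spaces `(U, X, Y)`, in the sense of Staffans.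
The extrapolation space `X_{-1}` is given as the space `Xm1` together with a dense
continuous embedding `ι : X → X_{-1}`; `Am1 : X → X_{-1}` is the extension
`A_{-1}` of the generator restricted to `X` (which is bounded from `X` to `X_{-1}`);
the domain of `A` is the set of `x ∈ X` with `A_{-1} x ∈ X`.  `R s` is the resolvent
`(s - A_{-1})^{-1} : X_{-1} → X`, defined (as specified by `R_right`, `R_left`) for
`Re s > ω(T)`.  `B : U → X_{-1}` is the control operator and `Cop` is the observation
operator `C : X_1 → Y`, encoded as a map on all of `X` that is linear and
`X_1`-bounded on the domain of `A`.  `G` is the transfer function. -/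
structure SystemNode (U : Type*) (X : Type*) (Xm1 : Type*) (Y : Type*)
    [NormedAddCommGroup U] [NormedSpace ℂ U]
    [NormedAddCommGroup X] [NormedSpace ℂ X]
    [NormedAddCommGroup Xm1] [NormedSpace ℂ Xm1]
    [NormedAddCommGroup Y] [NormedSpace ℂ Y] where
  S : C0Semigroup X
  Sm1 : C0Semigroup Xm1
  ι : X →L[ℂ] Xm1
  ι_injective : Function.Injective (fun x : X => ι x)
  ι_dense : DenseRange (fun x : X => ι x)
  semigroup_compat : ∀ t : ℝ, 0 ≤ t → ∀ x : X, Sm1.T t (ι x) = ι (S.T t x)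
  Am1 : X →L[ℂ] Xm1
  generator : ∀ x : X, ∀ t : ℝ, 0 ≤ t →
    HasDerivWithinAt (fun τ : ℝ => ι (S.T τ x)) (Am1 (S.T t x)) (Set.Ici 0) t
  B : U →L[ℂ] Xm1
  Cop : X → Y
  Cop_add : ∀ x₁ x₂ : X, (∃ z : X, Am1 x₁ = ι z) → (∃ z : X, Am1 x₂ = ι z) →
    Cop (x₁ + x₂) = Cop x₁ + Cop x₂
  Cop_smul : ∀ (a : ℂ) (x : X), (∃ z : X, Am1 x = ι z) → Cop (a • x) = a • Cop x
  Cop_bound : ∃ M : ℝ, ∀ x z : X, Am1 x = ι z → ‖Cop x‖ ≤ M * (‖x‖ + ‖z‖)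
  R : ℂ → Xm1 →L[ℂ] X
  R_right : ∀ s : ℂ, S.growthBound < s.re → ∀ w : Xm1, s • ι (R s w) - Am1 (R s w) = w
  R_left : ∀ s : ℂ, S.growthBound < s.re → ∀ x : X, R s (s • ι x - Am1 x) = x
  G : ℂ → U →L[ℂ] Y
  G_analytic : DifferentiableOn ℂ (fun s => G s) {s : ℂ | S.growthBound < s.re}
  G_shift : ∀ α β : ℂ, S.growthBound < α.re → S.growthBound < β.re → ∀ u : U,
    G α u - G β u = Cop (R α (B u) - R β (B u))

namespace SystemNode

variable {U X Xm1 Y : Type*}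
  [NormedAddCommGroup U] [NormedSpace ℂ U]
  [NormedAddCommGroup X] [NormedSpace ℂ X]
  [NormedAddCommGroup Xm1] [NormedSpace ℂ Xm1]
  [NormedAddCommGroup Y] [NormedSpace ℂ Y]

/-- The domain of the generator `A`: those `x ∈ X` with `A_{-1} x ∈ X`. -/
def domA (sys : SystemNode U X Xm1 Y) : Set X := {x : X | ∃ z : X, sys.Am1 x = sys.ι z}

/-- A fixed point in the half-plane of analyticity of the transfer function. -/
def betaPt (sys : SystemNode U X Xm1 Y) : ℂ := ((sys.S.growthBound + 1 : ℝ) : ℂ)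

/-- The combined observation/feedthrough operator
`C&D (x,u) = C[x - (β - A)⁻¹ B u] + G(β) u`. -/
def CD (sys : SystemNode U X Xm1 Y) (x : X) (u : U) : Y :=
  sys.Cop (x - sys.R sys.betaPt (sys.B u)) + sys.G sys.betaPt u

/-- The pair `(x,u)` belongs to the domain of the combined operator `C&D`,
i.e. `A_{-1} x + B u ∈ X`. -/
def memCD (sys : SystemNode U X Xm1 Y) (x : X) (u : U) : Prop :=
  ∃ z : X, sys.Am1 x + sys.B u = sys.ι z

/-- A classical solution `(u,x,y)` of the system node on `[0,∞)`:
`u, y` continuous, `x` continuously differentiable with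
`ẋ(t) = A x(t) + B u(t)` (in particular `(x(t),u(t)) ∈ D(C&D)`) and
`y(t) = C&D (x(t),u(t))` for all `t ≥ 0`. -/
def IsClassicalSolution (sys : SystemNode U X Xm1 Y)
    (u : ℝ → U) (x : ℝ → X) (y : ℝ → Y) : Prop :=
  ContinuousOn u (Set.Ici 0) ∧ ContinuousOn y (Set.Ici 0) ∧
  (∃ x' : ℝ → X, ContinuousOn x' (Set.Ici 0) ∧
    (∀ t ∈ Set.Ici (0:ℝ), HasDerivWithinAt x (x' t) (Set.Ici 0) t) ∧
    (∀ t ∈ Set.Ici (0:ℝ), sys.Am1 (x t) + sys.B (u t) = sys.ι (x' t))) ∧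
  (∀ t ∈ Set.Ici (0:ℝ), y t = sys.CD (x t) (u t))

/-- `C^∞`-BIBO stability: there is `c > 0` such that every classical solution with
zero initial state and smooth input compactly supported in `(0,∞)` has output
bounded by `c` times the sup-norm of the input. -/
def CInfBIBOStable (sys : SystemNode U X Xm1 Y) : Prop :=
  ∃ c : ℝ, 0 < c ∧ ∀ (u : ℝ → U) (x : ℝ → X) (y : ℝ → Y),
    sys.IsClassicalSolution u x y → x 0 = 0 →
    ContDiff ℝ (⊤ : ℕ∞) u → HasCompactSupport u → tsupport u ⊆ Set.Ioi 0 →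
    ∀ M : ℝ, (∀ s : ℝ, ‖u s‖ ≤ M) → ∀ t : ℝ, 0 ≤ t → ‖y t‖ ≤ c * M

/-- The state part of a generalised solution in the distributional sense:
`u ∈ L¹_loc`, `x` continuous `X_{-1}`-valued, given by the variation of
constants formula with initial state `x₀ ∈ X`. -/
def IsMildState (sys : SystemNode U X Xm1 Y) (x₀ : X) (u : ℝ → U) (xs : ℝ → Xm1) : Prop :=
  MeasureTheory.LocallyIntegrableOn u (Set.Ici 0) ∧
  ContinuousOn xs (Set.Ici 0) ∧
  ∀ t : ℝ, 0 ≤ t →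
    IntervalIntegrable (fun s => sys.Sm1.T (t - s) (sys.B (u s))) MeasureTheory.volume 0 t ∧
    xs t = sys.Sm1.T t (sys.ι x₀) + ∫ s in (0:ℝ)..t, sys.Sm1.T (t - s) (sys.B (u s))

/-- The output part of a generalised solution in the distributional sense: the
(locally integrable representative of the) `Y`-valued distribution
`y = d²/dt² ( C&D ∫_0^t (t-s) (x(s), u(s)) ds )`. -/
def IsGenOutput (sys : SystemNode U X Xm1 Y) (u : ℝ → U) (xs : ℝ → Xm1) (y : ℝ → Y) : Prop :=
  MeasureTheory.LocallyIntegrableOn y (Set.Ici 0) ∧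
  ∃ (K : ℝ → X) (L : ℝ → U),
    (∀ t : ℝ, 0 ≤ t → sys.ι (K t) = ∫ s in (0:ℝ)..t, (t - s) • xs s) ∧
    (∀ t : ℝ, 0 ≤ t → L t = ∫ s in (0:ℝ)..t, (t - s) • u s) ∧
    (∀ t : ℝ, 0 ≤ t → sys.memCD (K t) (L t)) ∧
    (∀ φ : ℝ → ℝ, ContDiff ℝ (⊤ : ℕ∞) φ → HasCompactSupport φ → tsupport φ ⊆ Set.Ioi 0 →
      ∫ t in Set.Ioi (0:ℝ), deriv (deriv φ) t • sys.CD (K t) (L t) =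
        ∫ t in Set.Ioi (0:ℝ), φ t • y t)

/-- A generalised solution in the distributional sense. -/
def IsGeneralizedSolution (sys : SystemNode U X Xm1 Y) (x₀ : X)
    (u : ℝ → U) (xs : ℝ → Xm1) (y : ℝ → Y) : Prop :=
  sys.IsMildState x₀ u xs ∧ sys.IsGenOutput u xs y

/-- `L^∞`-BIBO stability: there is `c > 0` such that for every generalised solution in
the distributional sense with zero initial state and locally essentially bounded input,
the output is represented by a locally essentially bounded function with
`‖y‖_{L^∞([0,t])} ≤ c ‖u‖_{L^∞([0,t])}` for all `t > 0`. -/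
def LInfBIBOStable (sys : SystemNode U X Xm1 Y) : Prop :=
  ∃ c : ℝ, 0 < c ∧ ∀ (u : ℝ → U) (xs : ℝ → Xm1),
    sys.IsMildState 0 u xs →
    (∀ t : ℝ, 0 < t → ∃ M : ℝ,
      ∀ᵐ s ∂(MeasureTheory.volume.restrict (Set.Ioc (0:ℝ) t)), ‖u s‖ ≤ M) →
    ∃ y : ℝ → Y, sys.IsGenOutput u xs y ∧
      ∀ t : ℝ, 0 < t → ∀ M : ℝ,
        (∀ᵐ s ∂(MeasureTheory.volume.restrict (Set.Ioc (0:ℝ) t)), ‖u s‖ ≤ M) →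
        (∀ᵐ s ∂(MeasureTheory.volume.restrict (Set.Ioc (0:ℝ) t)), ‖y s‖ ≤ c * M)

/-- `L^p`-control-admissibility of the control operator `B`. -/
def ControlAdmissible (sys : SystemNode U X Xm1 Y) (p : ℝ≥0∞) : Prop :=
  ∀ t : ℝ, 0 < t → ∃ M : ℝ, ∀ u : ℝ → U,
    IntervalIntegrable (fun s => sys.Sm1.T (t - s) (sys.B (u s))) MeasureTheory.volume 0 t →
    ∃ x : X, sys.ι x = ∫ s in (0:ℝ)..t, sys.Sm1.T (t - s) (sys.B (u s)) ∧
      ‖x‖ ≤ M * (eLpNorm u p (MeasureTheory.volume.restrict (Set.Ioc (0:ℝ) t))).toReal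

/-- Infinite-time `L^p`-control-admissibility: the admissibility constant can be chosen
uniformly in `t`. -/
def InfTimeControlAdmissible (sys : SystemNode U X Xm1 Y) (p : ℝ≥0∞) : Prop :=
  ∃ M : ℝ, ∀ t : ℝ, 0 < t → ∀ u : ℝ → U,
    IntervalIntegrable (fun s => sys.Sm1.T (t - s) (sys.B (u s))) MeasureTheory.volume 0 t →
    ∃ x : X, sys.ι x = ∫ s in (0:ℝ)..t, sys.Sm1.T (t - s) (sys.B (u s)) ∧
      ‖x‖ ≤ M * (eLpNorm u p (MeasureTheory.volume.restrict (Set.Ioc (0:ℝ) t))).toReal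

/-- `L^p`-observation-admissibility of the observation operator `C`. -/
def ObservationAdmissible (sys : SystemNode U X Xm1 Y) (p : ℝ≥0∞) : Prop :=
  ∃ t : ℝ, 0 < t ∧ ∃ M : ℝ, ∀ x z : X, sys.Am1 x = sys.ι z →
    (eLpNorm (fun s : ℝ => sys.Cop (sys.S.T s x)) p
      (MeasureTheory.volume.restrict (Set.Ioc (0:ℝ) t))).toReal ≤ M * ‖x‖

/-- `L²`-well-posedness of a system node: `B` and `C` are `L²`-admissible and the
transfer function is bounded on some right half-plane. -/
def L2WellPosed (sys : SystemNode U X Xm1 Y) : Prop :=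
  sys.ControlAdmissible 2 ∧ sys.ObservationAdmissible 2 ∧
  ∃ w : ℝ, sys.S.growthBound ≤ w ∧ ∃ M : ℝ, ∀ s : ℂ, w < s.re → ‖sys.G s‖ ≤ M

end SystemNode

/-- A (matrix/operator valued) Borel measure of bounded total variation on `[0,∞)`,
encoded through its polar decomposition: a finite positive measure `μ` supported on
`[0,∞)` together with a density `g` of norm one. -/
structure BVMeasure (U Y : Type*) [NormedAddCommGroup U] [NormedSpace ℂ U]
    [NormedAddCommGroup Y] [NormedSpace ℂ Y] where
  μ : MeasureTheory.Measure ℝ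
  finite : MeasureTheory.IsFiniteMeasure μ
  supported : μ (Set.Iio 0) = 0
  g : ℝ → U →L[ℂ] Y
  g_meas : MeasureTheory.AEStronglyMeasurable g μ
  g_norm : ∀ᵐ t ∂μ, ‖g t‖ = 1

namespace BVMeasure

variable {U Y : Type*} [NormedAddCommGroup U] [NormedSpace ℂ U]
  [NormedAddCommGroup Y] [NormedSpace ℂ Y]

/-- The total variation `‖h‖_M` of the measure. -/
def var (h : BVMeasure U Y) : ℝ := (h.μ Set.univ).toReal

/-- The Laplace transform `ĥ(s) u = ∫ e^{-st} dh(t) u`. -/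
def laplace (h : BVMeasure U Y) (s : ℂ) (u : U) : Y :=
  ∫ t, Complex.exp (-(s * t)) • (h.g t u) ∂h.μ

/-- The convolution `(h ∗ u)(t) = ∫_{[0,t]} dh(s) u(t - s)`. -/
def conv (h : BVMeasure U Y) (u : ℝ → U) (t : ℝ) : Y :=
  ∫ s in Set.Icc 0 t, (h.g s) (u (t - s)) ∂h.μ

end BVMeasure

/-- The Laplace transform of `h` coincides with the transfer function of the node on
the half-plane `ℂ_{ω(T)}` (on `ℂ_{ω(T)} ∩ ℂ_0`, identifying `ĥ` with its analytic
continuation). -/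
def LaplaceMatches {U X Xm1 Y : Type*}
    [NormedAddCommGroup U] [NormedSpace ℂ U]
    [NormedAddCommGroup X] [NormedSpace ℂ X]
    [NormedAddCommGroup Xm1] [NormedSpace ℂ Xm1]
    [NormedAddCommGroup Y] [NormedSpace ℂ Y]
    (sys : SystemNode U X Xm1 Y) (h : BVMeasure U Y) : Prop :=
  ∀ s : ℂ, sys.S.growthBound < s.re → 0 ≤ s.re → ∀ u : U, h.laplace s u = sys.G s u

/-- `sys'` is a system node for the multiplicatively perturbed triple `(AP, B, C)`. -/
def IsMultPerturbed {U X Xm1 Y : Type*}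
    [NormedAddCommGroup U] [NormedSpace ℂ U]
    [NormedAddCommGroup X] [NormedSpace ℂ X]
    [NormedAddCommGroup Xm1] [NormedSpace ℂ Xm1]
    [NormedAddCommGroup Y] [NormedSpace ℂ Y]
    (sys sys' : SystemNode U X Xm1 Y) (P : X →L[ℂ] X) : Prop :=
  sys'.ι = sys.ι ∧ sys'.Am1 = sys.Am1.comp P ∧ sys'.B = sys.B ∧ sys'.Cop = sys.Cop

/-- `sys'` is a system node for the additively perturbed triple `(A + P, B, C)`. -/
def IsAddPerturbed {U X Xm1 Y : Type*}
    [NormedAddCommGroup U] [NormedSpace ℂ U]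
    [NormedAddCommGroup X] [NormedSpace ℂ X]
    [NormedAddCommGroup Xm1] [NormedSpace ℂ Xm1]
    [NormedAddCommGroup Y] [NormedSpace ℂ Y]
    (sys sys' : SystemNode U X Xm1 Y) (P : X →L[ℂ] X) : Prop :=
  sys'.ι = sys.ι ∧ sys'.Am1 = sys.Am1 + sys.ι.comp P ∧ sys'.B = sys.B ∧ sys'.Cop = sys.Cop

end


section ConvAux
variable {E E' F : Type*} [NormedAddCommGroup E] [NormedSpace ℝ E]
  [NormedAddCommGroup E'] [NormedSpace ℝ E'] [NormedAddCommGroup F] [NormedSpace ℝ F]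

lemma aux_conv_prim [CompleteSpace E] [CompleteSpace F] (L : E →L[ℝ] E' →L[ℝ] F)
    {a : ℝ → E} (ha : Continuous a) {b : ℝ → E'} {t : ℝ} (ht : 0 ≤ t)
    (hb : IntervalIntegrable b volume 0 t) :
    ∫ s in (0:ℝ)..t, L (∫ r in (0:ℝ)..(t - s), a r) (b s) =
      ∫ s in (0:ℝ)..t, ∫ τ in (0:ℝ)..s, L (a (s - τ)) (b τ) := by
  have hb' : Integrable b (volume.restrict (Ioc 0 t)) :=
    (intervalIntegrable_iff_integrableOn_Ioc_of_le ht).1 hb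
  obtain ⟨C, hC⟩ := (isCompact_Icc (a := -t) (b := t)).exists_bound_of_continuousOn ha.continuousOn
  have hmeas : AEStronglyMeasurable (fun p : ℝ × ℝ => L (a (p.1 - p.2)) (b p.2))
      ((volume.restrict (Ioc 0 t)).prod (volume.restrict (Ioc 0 t))) := by
    refine L.aestronglyMeasurable_comp₂ ?_ ?_
    · exact (ha.comp (continuous_fst.sub continuous_snd)).aestronglyMeasurable
    · exact hb'.1.comp_snd
  have hint0 : Integrable (fun p : ℝ × ℝ => L (a (p.1 - p.2)) (b p.2))
      ((volume.restrict (Ioc 0 t)).prod (volume.restrict (Ioc 0 t))) := by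
    refine Integrable.mono' ((hb'.norm.comp_snd (volume.restrict (Ioc 0 t))).const_mul (‖L‖ * C)) hmeas ?_
    rw [Measure.prod_restrict]
    filter_upwards [ae_restrict_mem (measurableSet_Ioc.prod measurableSet_Ioc)] with p hp
    obtain ⟨⟨h1, h2⟩, h3, h4⟩ := hp
    calc ‖L (a (p.1 - p.2)) (b p.2)‖ ≤ ‖L‖ * ‖a (p.1 - p.2)‖ * ‖b p.2‖ := L.le_opNorm₂ _ _
      _ ≤ ‖L‖ * C * ‖b p.2‖ := by
        gcongr
        exact hC _ ⟨by linarith, by linarith⟩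
  have hS : MeasurableSet {p : ℝ × ℝ | p.2 ≤ p.1} := measurableSet_le measurable_snd measurable_fst
  have hint := hint0.indicator hS
  have hsw := integral_integral_swap (f := fun s τ => ({p : ℝ × ℝ | p.2 ≤ p.1}).indicator
    (fun p : ℝ × ℝ => L (a (p.1 - p.2)) (b p.2)) (s, τ)) hint
  rw [intervalIntegral.integral_of_le ht, intervalIntegral.integral_of_le ht]
  have h1 : ∀ s ∈ Ioc 0 t, ∫ τ in (0:ℝ)..s, L (a (s - τ)) (b τ) =
      ∫ τ in Ioc 0 t, ({p : ℝ × ℝ | p.2 ≤ p.1}).indicator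
        (fun p : ℝ × ℝ => L (a (p.1 - p.2)) (b p.2)) (s, τ) := by
    intro s hs
    have : (fun τ => ({p : ℝ × ℝ | p.2 ≤ p.1}).indicator
        (fun p : ℝ × ℝ => L (a (p.1 - p.2)) (b p.2)) (s, τ)) =
        (Iic s).indicator (fun τ => L (a (s - τ)) (b τ)) := by
      ext τ; simp [indicator]
    rw [this, setIntegral_indicator measurableSet_Iic, intervalIntegral.integral_of_le hs.1.le]
    congr 2
    ext τ; simp only [mem_Ioc, mem_inter_iff, mem_Iic]
    have := hs.2
    constructor
    · rintro ⟨h, h'⟩; exact ⟨⟨h, h'.trans this⟩, h'⟩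
    · rintro ⟨⟨h, _⟩, h'⟩; exact ⟨h, h'⟩
  have h2 : ∀ τ ∈ Ioc 0 t, L (∫ r in (0:ℝ)..(t - τ), a r) (b τ) =
      ∫ s in Ioc 0 t, ({p : ℝ × ℝ | p.2 ≤ p.1}).indicator
        (fun p : ℝ × ℝ => L (a (p.1 - p.2)) (b p.2)) (s, τ) := by
    intro τ hτ
    have : (fun s => ({p : ℝ × ℝ | p.2 ≤ p.1}).indicator
        (fun p : ℝ × ℝ => L (a (p.1 - p.2)) (b p.2)) (s, τ)) =
        (Ici τ).indicator (fun s => L (a (s - τ)) (b τ)) := by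
      ext s; simp [indicator]
    rw [this, setIntegral_indicator measurableSet_Ici]
    have hset : Ioc 0 t ∩ Ici τ = Icc τ t := by
      ext s; simp only [mem_Ioc, mem_inter_iff, mem_Ici, mem_Icc]
      have := hτ.1
      constructor
      · rintro ⟨⟨h, h'⟩, h''⟩; exact ⟨h'', h'⟩
      · rintro ⟨h, h'⟩; exact ⟨⟨this.trans_le h, h'⟩, h⟩
    rw [hset, integral_Icc_eq_integral_Ioc, ← intervalIntegral.integral_of_le hτ.2,
      intervalIntegral.integral_comp_sub_right (fun r => L (a r) (b τ)) τ, sub_self]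
    have := (L.flip (b τ)).intervalIntegral_comp_comm (a := 0) (b := t - τ)
      (ha.intervalIntegrable (μ := volume) 0 (t - τ))
    simpa using this.symm
  rw [setIntegral_congr_fun measurableSet_Ioc h1, setIntegral_congr_fun measurableSet_Ioc h2]
  exact hsw.symm

/-- Causal convolution with an operator kernel. -/
noncomputable def lconv (a : ℝ → E →L[ℝ] F) (b : ℝ → E) (t : ℝ) : F :=
  ∫ s in (0:ℝ)..t, a (t - s) (b s)

lemma lconv_prim_left [CompleteSpace F] {a a1 : ℝ → E →L[ℝ] F} (ha : Continuous a)
    (h1 : ∀ r, 0 ≤ r → a1 r = ∫ σ in (0:ℝ)..r, a σ) {b : ℝ → E} {t : ℝ} (ht : 0 ≤ t)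
    (hb : IntervalIntegrable b volume 0 t) :
    lconv a1 b t = ∫ s in (0:ℝ)..t, lconv a b s := by
  have := aux_conv_prim (ContinuousLinearMap.id ℝ (E →L[ℝ] F)) ha ht hb
  simp only [ContinuousLinearMap.id_apply] at this
  unfold lconv
  rw [← this]
  refine intervalIntegral.integral_congr fun s hs => ?_
  rw [uIcc_of_le ht] at hs
  simp only [h1 (t - s) (by linarith [hs.2])]

lemma lconv_flip (a : ℝ → E →L[ℝ] F) (b : ℝ → E) (t : ℝ) :
    lconv a b t = ∫ s in (0:ℝ)..t, a s (b (t - s)) := by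
  have := intervalIntegral.integral_comp_sub_left (a := 0) (b := t)
    (fun s => a s (b (t - s))) t
  simp only [sub_sub_cancel, sub_self, sub_zero] at this
  exact this

lemma lconv_prim_right [CompleteSpace F] [CompleteSpace E] {a : ℝ → E →L[ℝ] F} (ha : Continuous a)
    {b b1 : ℝ → E} (h1 : ∀ r, 0 ≤ r → b1 r = ∫ σ in (0:ℝ)..r, b σ) {t : ℝ} (ht : 0 ≤ t)
    (hb : Continuous b) :
    lconv a b1 t = ∫ s in (0:ℝ)..t, lconv a b s := by
  have := aux_conv_prim (ContinuousLinearMap.id ℝ (E →L[ℝ] F)).flip hb ht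
    (ha.intervalIntegrable 0 t)
  simp only [lconv_flip]
  simp only [ContinuousLinearMap.flip_apply, ContinuousLinearMap.id_apply] at this
  rw [← this]
  refine intervalIntegral.integral_congr fun s hs => ?_
  rw [uIcc_of_le ht] at hs
  simp only [h1 (t - s) (by linarith [hs.2])]

lemma lconv_continuous {a : ℝ → E →L[ℝ] F} (ha : Continuous a)
    {b : ℝ → E} (hb : Continuous b) : Continuous (lconv a b) := by
  unfold lconv
  refine intervalIntegral.continuous_parametric_intervalIntegral_of_continuous
    (f := fun t s => a (t - s) (b s)) ?_ continuous_id
  exact (ha.comp (continuous_fst.sub continuous_snd)).clm_apply (hb.comp continuous_snd)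

lemma lconv_integrable {a : ℝ → E →L[ℝ] F} (ha : Continuous a)
    {b : ℝ → E} {t : ℝ} (hb : IntervalIntegrable b volume 0 t) :
    IntervalIntegrable (fun s => a (t - s) (b s)) volume 0 t := by
  obtain ⟨C, hC⟩ := (isCompact_uIcc (a := 0) (b := t)).exists_bound_of_continuousOn
    (f := fun s => a (t - s)) (ha.comp (by fun_prop)).continuousOn
  refine (hb.norm.const_mul C).mono_fun' ?_ ?_
  · refine (ContinuousLinearMap.id ℝ (E →L[ℝ] F)).aestronglyMeasurable_comp₂ ?_ hb.def'.1
    exact (ha.comp (by fun_prop : Continuous fun s : ℝ => t - s)).aestronglyMeasurable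
  · filter_upwards [ae_restrict_mem measurableSet_uIoc] with s hs
    exact ((a (t - s)).le_opNorm _).trans (by gcongr; exact hC s (uIoc_subset_uIcc hs))

lemma prim_prim [CompleteSpace E] {v : ℝ → E} {t : ℝ} (ht : 0 ≤ t)
    (hv : IntervalIntegrable v volume 0 t) :
    ∫ s in (0:ℝ)..t, (t - s) • v s = ∫ s in (0:ℝ)..t, ∫ r in (0:ℝ)..s, v r := by
  have := lconv_prim_left (a := fun _ => ContinuousLinearMap.id ℝ E)
    (a1 := fun r => r • ContinuousLinearMap.id ℝ E) continuous_const
    (by intro r _; simp) ht hv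
  simpa [lconv] using this

end ConvAux

section DistAux
variable {Y : Type*} [NormedAddCommGroup Y] [NormedSpace ℝ Y]

lemma limit_deriv [CompleteSpace Y] {T C : ℝ} (hC : 0 ≤ C) {Fn En : ℕ → ℝ → Y} {F : ℝ → Y}
    (h1 : ∀ n, ∀ s ∈ Ioo 0 T, ∀ t ∈ Ioo 0 T, ‖En n t - En n s‖ ≤ C * |t - s|)
    (h2 : ∀ n, ∀ s ∈ Ioo 0 T, ∀ t ∈ Ioo 0 T,
      ‖Fn n t - Fn n s - (t - s) • En n s‖ ≤ C * |t - s| ^ 2)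
    (h3 : ∀ s ∈ Ioo 0 T, Filter.Tendsto (fun n => Fn n s) Filter.atTop (𝓝 (F s))) :
    ∃ E : ℝ → Y, (∀ s ∈ Ioo 0 T, HasDerivAt F (E s) s) ∧
      ∀ s ∈ Ioo 0 T, ∀ t ∈ Ioo 0 T, ‖E t - E s‖ ≤ C * |t - s| := by
  have hc : ∀ s ∈ Ioo 0 T, ∃ e, Filter.Tendsto (fun n => En n s) Filter.atTop (𝓝 e) := by
    intro s hs
    apply cauchySeq_tendsto_of_complete
    rw [Metric.cauchySeq_iff']
    intro ε hε
    obtain ⟨h, hh0, hhT, hhε⟩ : ∃ h, 0 < h ∧ s + h < T ∧ 2 * C * h < ε / 2 := by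
      refine ⟨min ((T - s) / 2) (ε / (4 * C + 4) / 2), ?_, ?_, ?_⟩
      · have := hs.2; apply lt_min <;> [linarith; positivity]
      · have := min_le_left ((T - s) / 2) (ε / (4 * C + 4) / 2); have := hs.2; linarith
      · have := min_le_right ((T - s) / 2) (ε / (4 * C + 4) / 2)
        have h4 : 0 < ε / (4 * C + 4) := by positivity
        have h5 : ε / (4 * C + 4) * (4 * C + 4) = ε := by field_simp
        nlinarith
    have hsh : s + h ∈ Ioo 0 T := ⟨by linarith [hs.1], hhT⟩
    have hcA := (Metric.cauchySeq_iff'.1 (h3 s hs).cauchySeq) (ε * h / 8) (by positivity)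
    have hcB := (Metric.cauchySeq_iff'.1 (h3 _ hsh).cauchySeq) (ε * h / 8) (by positivity)
    have hcA' := (Metric.cauchySeq_iff.1 (h3 s hs).cauchySeq) (ε * h / 8) (by positivity)
    have hcB' := (Metric.cauchySeq_iff.1 (h3 _ hsh).cauchySeq) (ε * h / 8) (by positivity)
    obtain ⟨N1, hN1⟩ := hcA'
    obtain ⟨N2, hN2⟩ := hcB'
    refine ⟨max N1 N2, fun n hn => ?_⟩
    have e1 := hN1 n ((le_max_left _ _).trans hn) (max N1 N2) (le_max_left _ _)
    have e2 := hN2 n ((le_max_right _ _).trans hn) (max N1 N2) (le_max_right _ _)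
    have e3 := h2 n s hs _ hsh
    have e4 := h2 (max N1 N2) s hs _ hsh
    rw [dist_eq_norm] at *
    generalize max N1 N2 = m at *
    have ee : (s + h - s) • (En n s - En m s) = (Fn n (s + h) - Fn m (s + h)) - (Fn n s - Fn m s)
      - (Fn n (s + h) - Fn n s - (s + h - s) • En n s)
      + (Fn m (s + h) - Fn m s - (s + h - s) • En m s) := by
      rw [smul_sub]; abel
    have e5 : h * ‖En n s - En m s‖ ≤ ε * h / 8 + ε * h / 8 + C * |s + h - s| ^ 2
        + C * |s + h - s| ^ 2 := by
      calc h * ‖En n s - En m s‖ = ‖(s + h - s) • (En n s - En m s)‖ := by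
            rw [norm_smul, add_sub_cancel_left, Real.norm_of_nonneg hh0.le]
        _ ≤ _ := by
            rw [ee]
            refine (norm_add_le _ _).trans (add_le_add ((norm_sub_le _ _).trans (add_le_add
              ((norm_sub_le _ _).trans (add_le_add e2.le e1.le)) e3)) e4)
    rw [add_sub_cancel_left, abs_of_pos hh0] at e5
    have : h * ‖En n s - En m s‖ < h * ε := by nlinarith
    exact lt_of_mul_lt_mul_left this hh0.le
  choose! E hE using hc
  refine ⟨E, fun s hs => ?_, fun s hs t ht => ?_⟩
  · have key : ∀ t ∈ Ioo 0 T, ‖F t - F s - (t - s) • E s‖ ≤ C * |t - s| ^ 2 := by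
      intro t ht
      refine le_of_tendsto' (((h3 t ht).sub (h3 s hs)).sub ((hE s hs).const_smul (t - s))).norm
        (fun n => h2 n s hs t ht)
    rw [hasDerivAt_iff_isLittleO]
    have hO : (fun t => F t - F s - (t - s) • E s) =O[𝓝 s] fun t => (t - s) ^ 2 := by
      refine Asymptotics.IsBigO.of_bound C ?_
      filter_upwards [Ioo_mem_nhds hs.1 hs.2] with t ht
      simpa using key t ht
    refine hO.trans_isLittleO ?_
    have := (Asymptotics.isLittleO_pow_id (𝕜 := ℝ) (n := 2) (by norm_num))
    have h0 : Filter.Tendsto (fun t => t - s) (𝓝 s) (𝓝 0) := by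
      have : Continuous fun t : ℝ => t - s := by fun_prop
      simpa using this.tendsto s
    exact this.comp_tendsto h0
  · exact le_of_tendsto' ((hE t ht).sub (hE s hs)).norm (fun n => h1 n s hs t ht)

/-- test functions vanish off a compact subinterval -/
lemma test_bounds {φ : ℝ → ℝ} (hc : HasCompactSupport φ) (hs : tsupport φ ⊆ Ioi 0) :
    ∃ a b : ℝ, 0 < a ∧ a < b ∧ tsupport φ ⊆ Ioo a b := by
  rcases (tsupport φ).eq_empty_or_nonempty with h | h
  · exact ⟨1, 2, by norm_num, by norm_num, by simp [h]⟩
  · obtain ⟨m, hm, hm'⟩ := hc.isCompact.exists_isMinOn h continuousOn_id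
    obtain ⟨M, hM, hM'⟩ := hc.isCompact.exists_isMaxOn h continuousOn_id
    have h0 : 0 < m := hs hm
    have h1 : m ≤ M := hm' hM
    refine ⟨m / 2, M + 1, by linarith, by linarith, fun x hx => ⟨?_, ?_⟩⟩
    · have : m ≤ x := hm' hx
      linarith
    · have : x ≤ M := hM' hx
      linarith

lemma integral_Ioi_eq {f : ℝ → Y} {a b : ℝ} (ha : 0 < a) (hab : a < b)
    (h : ∀ x, x ∉ Ioo a b → f x = 0) : ∫ t in Ioi (0:ℝ), f t = ∫ t in a..b, f t := by
  rw [intervalIntegral.integral_of_le hab.le]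
  refine setIntegral_eq_of_subset_of_forall_sdiff_eq_zero measurableSet_Ioi ?_ ?_
  · exact fun x hx => ha.trans hx.1
  · intro x hx
    exact h x fun h' => hx.2 ⟨h'.1, h'.2.le⟩

/-- smooth integration by parts against a test function -/
lemma ibp_smooth [CompleteSpace Y] {F E : ℝ → Y} (hF : ∀ t, 0 < t → HasDerivAt F (E t) t)
    (hE : ContinuousOn E (Ioi 0)) {φ : ℝ → ℝ} (hφ : ContDiff ℝ 1 φ) (hc : HasCompactSupport φ)
    (hs : tsupport φ ⊆ Ioi 0) :
    ∫ t in Ioi (0:ℝ), deriv φ t • F t = - ∫ t in Ioi (0:ℝ), φ t • E t := by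
  obtain ⟨a, b, ha, hab, hsub⟩ := test_bounds hc hs
  have z1 : ∀ x, x ∉ Ioo a b → φ x = 0 := fun x hx => image_eq_zero_of_notMem_tsupport (fun h => hx (hsub h))
  have z2 : ∀ x, x ∉ Ioo a b → deriv φ x = 0 := fun x hx =>
    image_eq_zero_of_notMem_tsupport (fun h => hx (hsub (tsupport_deriv_subset h)))
  rw [integral_Ioi_eq ha hab (fun x hx => by rw [z2 x hx, zero_smul]),
    integral_Ioi_eq ha hab (fun x hx => by rw [z1 x hx, zero_smul])]
  have hsub' : uIcc a b ⊆ Ioi 0 := by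
    rw [uIcc_of_le hab.le]; exact fun x hx => ha.trans_le hx.1
  have hFc : ContinuousOn F (uIcc a b) := fun x hx =>
    (hF x (hsub' hx)).continuousAt.continuousWithinAt
  have hφ' : Continuous (deriv φ) := hφ.continuous_deriv le_rfl
  have i1 : IntervalIntegrable (fun t => deriv φ t • F t) volume a b :=
    (hφ'.continuousOn.smul hFc).intervalIntegrable
  have i2 : IntervalIntegrable (fun t => φ t • E t) volume a b :=
    (hφ.continuous.continuousOn.smul (hE.mono hsub')).intervalIntegrable
  have := intervalIntegral.integral_eq_sub_of_hasDerivAt (a := a) (b := b)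
    (f := fun t => φ t • F t) (f' := fun t => φ t • E t + deriv φ t • F t)
    (fun t ht => ((hφ.differentiable one_ne_zero t).hasDerivAt.smul (hF t (hsub' ht))))
    (i2.add i1)
  rw [intervalIntegral.integral_add i2 i1, z1 a (by simp), z1 b (by simp)] at this
  simp only [zero_smul, sub_zero] at this
  rw [eq_neg_iff_add_eq_zero, add_comm]; exact this

/-- local Lipschitz integration by parts against a test function -/
lemma ibp_lip [FiniteDimensional ℝ Y] {E : ℝ → Y}
    (hE : ∀ T, 0 < T → ∃ C : ℝ≥0, LipschitzOnWith C E (Ioo 0 T))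
    {φ : ℝ → ℝ} (hφ : ContDiff ℝ 1 φ) (hc : HasCompactSupport φ)
    (hs : tsupport φ ⊆ Ioi 0) :
    ∫ t in Ioi (0:ℝ), deriv φ t • E t = - ∫ t in Ioi (0:ℝ), φ t • deriv E t := by
  have : CompleteSpace Y := FiniteDimensional.complete ℝ Y
  obtain ⟨a, b, ha, hab, hsub⟩ := test_bounds hc hs
  have z1 : ∀ x, x ∉ Ioo a b → φ x = 0 := fun x hx => image_eq_zero_of_notMem_tsupport (fun h => hx (hsub h))
  have z2 : ∀ x, x ∉ Ioo a b → deriv φ x = 0 := fun x hx =>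
    image_eq_zero_of_notMem_tsupport (fun h => hx (hsub (tsupport_deriv_subset h)))
  rw [integral_Ioi_eq ha hab (fun x hx => by rw [z2 x hx, zero_smul]),
    integral_Ioi_eq ha hab (fun x hx => by rw [z1 x hx, zero_smul])]
  obtain ⟨C, hC⟩ := hE (b + 1) (by linarith)
  have hsub' : uIcc a b ⊆ Ioo 0 (b + 1) := by
    rw [uIcc_of_le hab.le]; exact fun x hx => ⟨ha.trans_le hx.1, by linarith [hx.2]⟩
  have hφ' : Continuous (deriv φ) := hφ.continuous_deriv le_rfl
  have hbd : ∀ t ∈ Ioo 0 (b+1), ‖deriv E t‖ ≤ C := fun t ht =>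
    norm_deriv_le_of_lipschitzOn (isOpen_Ioo.mem_nhds ht) hC
  have i1 : IntervalIntegrable (fun t => deriv φ t • E t) volume a b :=
    (hφ'.continuousOn.smul (hC.continuousOn.mono hsub')).intervalIntegrable
  have iE : IntervalIntegrable (fun t => deriv E t) volume a b := by
    refine (intervalIntegrable_const (c := (C : ℝ))).mono_fun' ?_ ?_
    · exact (stronglyMeasurable_deriv E).aestronglyMeasurable
    · filter_upwards [ae_restrict_mem measurableSet_uIoc] with s hs
      exact hbd s (hsub' (uIoc_subset_uIcc hs))
  have i2 : IntervalIntegrable (fun t => φ t • deriv E t) volume a b :=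
    iE.continuousOn_smul hφ.continuous.continuousOn
  have hd : ∀ᵐ t, t ∈ Ioo 0 (b+1) → DifferentiableAt ℝ E t := by
    filter_upwards [hC.ae_differentiableWithinAt_of_mem] with t ht hm
    exact (ht hm).differentiableAt (isOpen_Ioo.mem_nhds hm)
  rw [eq_neg_iff_add_eq_zero, ← intervalIntegral.integral_add i1 i2]
  refine (SeparatingDual.eq_zero_iff_forall_dual_eq_zero (R := ℝ) _).2 fun l => ?_
  rw [← l.intervalIntegral_comp_comm (i1.add i2)]
  have hAC1 : AbsolutelyContinuousOnInterval φ a b := by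
    obtain ⟨K, hK⟩ := hφ.lipschitzWith_of_hasCompactSupport hc one_ne_zero
    exact (hK.lipschitzOnWith).absolutelyContinuousOnInterval
  have hAC2 : AbsolutelyContinuousOnInterval (fun t => l (E t)) a b :=
    ((l.lipschitz.comp_lipschitzOnWith (hC.mono hsub'))).absolutelyContinuousOnInterval
  have := hAC1.integral_deriv_mul_eq_sub hAC2
  rw [z1 a (by simp), z1 b (by simp), zero_mul, zero_mul, sub_zero] at this
  rw [← this]
  refine intervalIntegral.integral_congr_ae ?_
  filter_upwards [hd] with t ht hm
  have h' := (ht (hsub' (uIoc_subset_uIcc hm))).hasDerivAt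
  have : deriv (fun t => l (E t)) t = l (deriv E t) :=
    (l.hasFDerivAt.comp_hasDerivAt t h').deriv
  simp [this]

end DistAux

section Moll
open scoped Convolution
variable {U : Type*} [NormedAddCommGroup U] [NormedSpace ℝ U] [FiniteDimensional ℝ U]

lemma mollify {u : ℝ → U} {T M : ℝ} (hT : 0 < T)
    (hu : IntegrableOn u (Ioc 0 T))
    (hM : ∀ᵐ s ∂(volume.restrict (Ioc (0:ℝ) T)), ‖u s‖ ≤ M) :
    ∃ v : ℕ → ℝ → U, (∀ n, ContDiff ℝ (⊤ : ℕ∞) (v n)) ∧ (∀ n, HasCompactSupport (v n)) ∧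
      (∀ n, tsupport (v n) ⊆ Ioi 0) ∧ (∀ n s, ‖v n s‖ ≤ M) ∧
      ∀ᵐ s, s ∈ Ioc 0 T → Filter.Tendsto (fun n => v n s) Filter.atTop (𝓝 (u s)) := by
  have : CompleteSpace U := FiniteDimensional.complete ℝ U
  have hM0 : 0 ≤ M := by
    have : (ae (volume.restrict (Ioc (0:ℝ) T))).NeBot := by
      rw [ae_neBot]; simp [Measure.restrict_eq_zero, hT]
    obtain ⟨s, hs⟩ := hM.exists
    exact (norm_nonneg _).trans hs
  let φ : ℕ → ContDiffBump (0:ℝ) := fun n =>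
    ⟨1 / ((n:ℝ) + 1) / 2, 1 / ((n:ℝ) + 1), by positivity, half_lt_self (by positivity)⟩
  have hr : ∀ n, (φ n).rOut = 1 / ((n:ℝ) + 1) := fun n => rfl
  let w : ℕ → ℝ → U := fun n => (Ioc (2 / ((n:ℝ) + 1)) T).indicator u
  let w0 : ℝ → U := (Ioc 0 T).indicator u
  have hw0 : Integrable w0 := hu.integrable_indicator measurableSet_Ioc
  have hw : ∀ n, Integrable (w n) := fun n =>
    (hu.mono_set (Ioc_subset_Ioc_left (by positivity))).integrable_indicator measurableSet_Ioc
  have hwM : ∀ n, ∀ᵐ s, ‖w n s‖ ≤ M := by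
    intro n
    filter_upwards [(ae_restrict_iff' measurableSet_Ioc).1 hM] with s hs
    by_cases h : s ∈ Ioc (2 / ((n:ℝ) + 1)) T
    · simp only [w, indicator_of_mem h]
      exact hs ⟨lt_trans (by positivity) h.1, h.2⟩
    · simpa only [w, indicator_of_notMem h, norm_zero] using hM0
  let v : ℕ → ℝ → U := fun n => (φ n).normed volume ⋆[ContinuousLinearMap.lsmul ℝ ℝ, volume] w n
  have hsup : ∀ n, Function.support (v n) ⊆ Icc (1 / ((n:ℝ) + 1)) (T + 1 / ((n:ℝ) + 1)) := by
    intro n s hs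
    have := support_convolution_subset_swap (ContinuousLinearMap.lsmul ℝ ℝ) (μ := volume) hs
    rw [mem_add] at this
    obtain ⟨x, hx, y, hy, rfl⟩ := this
    have hx' : x ∈ Ioc (2 / ((n:ℝ) + 1)) T := by
      by_contra h; exact hx (indicator_of_notMem h _)
    rw [(φ n).support_normed_eq, Metric.mem_ball, dist_zero_right, hr, Real.norm_eq_abs, abs_lt] at hy
    have : 2 / ((n:ℝ) + 1) = 1 / ((n:ℝ) + 1) + 1 / ((n:ℝ) + 1) := by ring
    constructor <;> linarith [hx'.1, hx'.2, hy.1, hy.2]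
  refine ⟨v, fun n => ?_, fun n => ?_, fun n => ?_, fun n s => ?_, ?_⟩
  · exact ((φ n).hasCompactSupport_normed).contDiff_convolution_left _ (φ n).contDiff_normed
      (hw n).locallyIntegrable
  · exact HasCompactSupport.intro isCompact_Icc fun x hx => by
      by_contra h; exact hx (hsup n h)
  · refine (closure_minimal (hsup n) isClosed_Icc).trans fun x hx => ?_
    exact lt_of_lt_of_le (by positivity) hx.1
  · have h1 : ‖v n s‖ ≤ ∫ t, (φ n).normed volume t * M := by
      refine norm_integral_le_of_norm_le ?_ ?_
      · exact ((φ n).integrable_normed).mul_const M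
      · have := (Measure.measurePreserving_sub_left (volume : Measure ℝ) s).quasiMeasurePreserving.ae (hwM n)
        filter_upwards [this] with t ht
        rw [ContinuousLinearMap.lsmul_apply, norm_smul, Real.norm_of_nonneg ((φ n).nonneg_normed t)]
        exact mul_le_mul_of_nonneg_left ht ((φ n).nonneg_normed t)
    rwa [integral_mul_const, (φ n).integral_normed, one_mul] at h1
  · have hlim : Filter.Tendsto (fun n : ℕ => 1 / ((n:ℝ) + 1)) Filter.atTop (𝓝 0) :=
      tendsto_one_div_add_atTop_nhds_zero_nat
    have := ContDiffBump.ae_convolution_tendsto_right_of_locallyIntegrable (φ := φ) (K := 2)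
      (μ := volume) (l := Filter.atTop) hlim
      (Filter.Eventually.of_forall fun n => by change 1 / ((n:ℝ) + 1) ≤ 2 * (1 / ((n:ℝ) + 1) / 2); linarith)
      hw0.locallyIntegrable
    filter_upwards [this] with s hs hsT
    have e : w0 s = u s := indicator_of_mem hsT _
    rw [e] at hs
    refine hs.congr' ?_
    have hev : ∀ᶠ n : ℕ in Filter.atTop, 1 / ((n:ℝ) + 1) < s / 3 :=
      hlim.eventually_lt_const (by linarith [hsT.1])
    filter_upwards [hev] with n hn
    simp only [v, convolution_def]
    refine integral_congr_ae (Filter.Eventually.of_forall fun t => ?_)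
    by_cases ht : t ∈ Metric.ball (0:ℝ) (φ n).rOut
    · simp only
      congr 1
      rw [Metric.mem_ball, dist_zero_right, hr, Real.norm_eq_abs, abs_lt] at ht
      have e2 : 2 / ((n:ℝ) + 1) = 1 / ((n:ℝ) + 1) + 1 / ((n:ℝ) + 1) := by ring
      simp only [w0, w]
      by_cases h : s - t ∈ Ioc 0 T
      · rw [indicator_of_mem h, indicator_of_mem]
        exact ⟨by linarith [ht.2], h.2⟩
      · rw [indicator_of_notMem h, indicator_of_notMem]
        exact fun h' => h ⟨lt_trans (by positivity) h'.1, h'.2⟩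
    · have : (φ n).normed volume t = 0 := by
        rw [← (φ n).support_normed_eq (μ := volume)] at ht
        simpa using ht
      simp [this]

end Moll

section Abs
variable {U Y : Type*} [NormedAddCommGroup U] [NormedSpace ℝ U] [FiniteDimensional ℝ U]
  [NormedAddCommGroup Y] [NormedSpace ℝ Y] [CompleteSpace Y]


lemma test_zero {u : ℝ → U} (hs : tsupport u ⊆ Ioi 0) : u 0 = 0 :=
  image_eq_zero_of_notMem_tsupport fun h => lt_irrefl (0:ℝ) (hs h)

lemma lconv_deriv {k : ℝ → U →L[ℝ] Y} (hk : Continuous k) {u : ℝ → U} (hu : ContDiff ℝ 1 u)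
    (h0 : u 0 = 0) :
    (∀ t, 0 ≤ t → lconv k u t = ∫ s in (0:ℝ)..t, lconv k (deriv u) s) ∧
    ∀ t, 0 < t → HasDerivAt (lconv k u) (lconv k (deriv u) t) t := by
  have : CompleteSpace U := FiniteDimensional.complete ℝ U
  have hu' : Continuous (deriv u) := hu.continuous_deriv le_rfl
  have key : ∀ t, 0 ≤ t → lconv k u t = ∫ s in (0:ℝ)..t, lconv k (deriv u) s := by
    intro t ht
    refine lconv_prim_right hk (fun r _ => ?_) ht hu'
    rw [intervalIntegral.integral_deriv_eq_sub (fun x _ => hu.differentiable one_ne_zero x)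
      (hu'.intervalIntegrable _ _), h0, sub_zero]
  refine ⟨key, fun t ht => ?_⟩
  have h1 := (lconv_continuous hk hu').integral_hasStrictDerivAt 0 t
  refine h1.hasDerivAt.congr_of_eventuallyEq ?_
  filter_upwards [Ioi_mem_nhds ht] with s hs
  exact key s hs.le

/-- bounds for the output integrals of a smooth input -/
lemma smooth_bounds {k : ℝ → U →L[ℝ] Y} (hk : Continuous k) {u : ℝ → U}
    (hu : ContDiff ℝ (⊤ : ℕ∞) u) (hs : tsupport u ⊆ Ioi 0) {C : ℝ}
    (hC : ∀ t, 0 ≤ t → ‖lconv k (deriv (deriv u)) t‖ ≤ C) :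
    (∀ s, 0 < s → ∀ t, 0 < t → ‖lconv k (deriv u) t - lconv k (deriv u) s‖ ≤ C * |t - s|) ∧
    (∀ s, 0 < s → ∀ t, 0 < t →
      ‖lconv k u t - lconv k u s - (t - s) • lconv k (deriv u) s‖ ≤ C * |t - s| ^ 2) := by
  have hu1 : ContDiff ℝ 1 u := hu.of_le (by exact_mod_cast le_top)
  have hdu : ContDiff ℝ 1 (deriv u) := by
    exact (contDiff_infty_iff_deriv.1 hu).2.of_le (by exact_mod_cast le_top)
  have d1 := (lconv_deriv hk hu1 (test_zero hs)).2
  have d2 := (lconv_deriv hk hdu (test_zero (tsupport_deriv_subset.trans hs))).2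
  have b1 : ∀ s, 0 < s → ∀ t, 0 < t →
      ‖lconv k (deriv u) t - lconv k (deriv u) s‖ ≤ C * |t - s| := by
    intro s hs t ht
    have := (convex_Ioi (0:ℝ)).norm_image_sub_le_of_norm_hasDerivWithin_le
      (fun x hx => (d2 x hx).hasDerivWithinAt) (fun x hx => hC x (le_of_lt hx)) (mem_Ioi.2 hs) (mem_Ioi.2 ht)
    simpa using this
  refine ⟨b1, fun s hs t ht => ?_⟩
  have hsub : uIcc s t ⊆ Ioi 0 := fun x hx => lt_of_lt_of_le (lt_min hs ht) hx.1
  have := (convex_uIcc s t).norm_image_sub_le_of_norm_hasDerivWithin_le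
    (f := fun x => lconv k u x - x • lconv k (deriv u) s)
    (f' := fun x => lconv k (deriv u) x - (1:ℝ) • lconv k (deriv u) s) (C := C * |t - s|)
    (fun x hx => ((d1 x (hsub hx)).sub ((hasDerivAt_id x).smul_const _)).hasDerivWithinAt)
    (fun x hx => ?_) left_mem_uIcc right_mem_uIcc
  · calc _ = ‖lconv k u t - t • lconv k (deriv u) s - (lconv k u s - s • lconv k (deriv u) s)‖ := by
          rw [sub_smul]; congr 1; abel
      _ ≤ _ := this
      _ = _ := by rw [Real.norm_eq_abs]; ring
  · rw [one_smul]
    refine (b1 s hs x (hsub hx)).trans ?_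
    have hC0 : 0 ≤ C := (norm_nonneg _).trans (hC 0 le_rfl)
    refine mul_le_mul_of_nonneg_left ?_ hC0
    exact abs_sub_left_of_mem_uIcc hx

lemma abs_local {k : ℝ → U →L[ℝ] Y} (hk : Continuous k) {c : ℝ} (hc : 0 < c)
    (H : ∀ u : ℝ → U, ContDiff ℝ (⊤ : ℕ∞) u → HasCompactSupport u → tsupport u ⊆ Ioi 0 →
      ∀ M : ℝ, (∀ s, ‖u s‖ ≤ M) → ∀ t, 0 ≤ t → ‖lconv k (deriv (deriv u)) t‖ ≤ c * M)
    {u : ℝ → U} {T M : ℝ} (hT : 0 < T) (hu : IntegrableOn u (Ioc 0 T))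
    (hM : ∀ᵐ s ∂(volume.restrict (Ioc (0:ℝ) T)), ‖u s‖ ≤ M) :
    ∃ E : ℝ → Y, (∀ s ∈ Ioo 0 T, HasDerivAt (lconv k u) (E s) s) ∧
      ∀ s ∈ Ioo 0 T, ∀ t ∈ Ioo 0 T, ‖E t - E s‖ ≤ (c * M) * |t - s| := by
  obtain ⟨v, v1, v2, v3, v4, v5⟩ := mollify hT hu hM
  have hM0 : 0 ≤ M := (norm_nonneg _).trans (v4 0 0)
  have hb := fun n => smooth_bounds hk (v1 n) (v3 n) (H (v n) (v1 n) (v2 n) (v3 n) M (v4 n))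
  refine limit_deriv (by positivity) (Fn := fun n => lconv k (v n))
    (En := fun n => lconv k (deriv (v n)))
    (fun n s hs t ht => (hb n).1 s hs.1 t ht.1) (fun n s hs t ht => (hb n).2 s hs.1 t ht.1) ?_
  intro t ht
  obtain ⟨C, hC⟩ := (isCompact_uIcc (a := 0) (b := t)).exists_bound_of_continuousOn
    (f := fun s => k (t - s)) (hk.comp (by fun_prop)).continuousOn
  refine intervalIntegral.tendsto_integral_filter_of_dominated_convergence (fun _ => C * M) ?_ ?_ ?_ ?_
  · refine Filter.Eventually.of_forall fun n => Continuous.aestronglyMeasurable ?_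
    exact (hk.comp (by fun_prop)).clm_apply (v1 n).continuous
  · refine Filter.Eventually.of_forall fun n => Filter.Eventually.of_forall fun s hs => ?_
    refine ((k (t - s)).le_opNorm _).trans ?_
    have h1 := hC s (uIoc_subset_uIcc hs)
    exact mul_le_mul h1 (v4 n s) (norm_nonneg _) ((norm_nonneg _).trans h1)
  · exact intervalIntegrable_const
  · filter_upwards [v5] with s hs hst
    rw [uIoc_of_le ht.1.le] at hst
    exact ((k (t - s)).continuous.tendsto _).comp (hs ⟨hst.1, hst.2.trans ht.2.le⟩)

lemma abs_main [FiniteDimensional ℝ Y] {k : ℝ → U →L[ℝ] Y} (hk : Continuous k) {c : ℝ} (hc : 0 < c)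
    (H : ∀ u : ℝ → U, ContDiff ℝ (⊤ : ℕ∞) u → HasCompactSupport u → tsupport u ⊆ Ioi 0 →
      ∀ M : ℝ, (∀ s, ‖u s‖ ≤ M) → ∀ t, 0 ≤ t → ‖lconv k (deriv (deriv u)) t‖ ≤ c * M)
    {u : ℝ → U} (hu : ∀ T, 0 < T → IntegrableOn u (Ioc 0 T))
    (hM : ∀ T, 0 < T → ∃ M, ∀ᵐ s ∂(volume.restrict (Ioc (0:ℝ) T)), ‖u s‖ ≤ M) :
    ∃ y : ℝ → Y, LocallyIntegrableOn y (Ici 0) ∧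
    (∀ φ : ℝ → ℝ, ContDiff ℝ (⊤ : ℕ∞) φ → HasCompactSupport φ → tsupport φ ⊆ Set.Ioi 0 →
      ∫ t in Set.Ioi (0:ℝ), deriv (deriv φ) t • lconv k u t =
        ∫ t in Set.Ioi (0:ℝ), φ t • y t) ∧
    ∀ t : ℝ, 0 < t → ∀ M : ℝ,
        (∀ᵐ s ∂(MeasureTheory.volume.restrict (Set.Ioc (0:ℝ) t)), ‖u s‖ ≤ M) →
        (∀ᵐ s ∂(MeasureTheory.volume.restrict (Set.Ioc (0:ℝ) t)), ‖y s‖ ≤ c * M) := by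
  let E : ℝ → Y := deriv (lconv k u)
  have hloc : ∀ T, 0 < T → ∀ M, (∀ᵐ s ∂(volume.restrict (Ioc (0:ℝ) T)), ‖u s‖ ≤ M) →
      (∀ s ∈ Ioo 0 T, HasDerivAt (lconv k u) (E s) s) ∧
      ∀ s ∈ Ioo 0 T, ∀ t ∈ Ioo 0 T, ‖E t - E s‖ ≤ (c * M) * |t - s| := by
    intro T hT M hTM
    obtain ⟨E', h1, h2⟩ := abs_local hk hc H hT (hu T hT) hTM
    have he : ∀ s ∈ Ioo 0 T, E s = E' s := fun s hs => (h1 s hs).deriv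
    refine ⟨fun s hs => by rw [he s hs]; exact h1 s hs, fun s hs t ht => ?_⟩
    rw [he s hs, he t ht]; exact h2 s hs t ht
  have hbd : ∀ t : ℝ, 0 < t → ∀ M : ℝ,
        (∀ᵐ s ∂(MeasureTheory.volume.restrict (Set.Ioc (0:ℝ) t)), ‖u s‖ ≤ M) →
        LipschitzOnWith (c * M).toNNReal E (Ioo 0 t) ∧ 0 ≤ c * M ∧
        (∀ᵐ s ∂(MeasureTheory.volume.restrict (Set.Ioc (0:ℝ) t)), ‖deriv E s‖ ≤ c * M) := by
    intro t ht M htM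
    have h2 := (hloc t ht M htM).2
    have h0 : 0 ≤ c * M := by
      have := (norm_nonneg _).trans (h2 (t/2) ⟨by linarith, by linarith⟩ (t/3) ⟨by linarith, by linarith⟩)
      refine nonneg_of_mul_nonneg_left this (abs_pos.2 ?_)
      linarith
    have hl : LipschitzOnWith (c * M).toNNReal E (Ioo 0 t) := by
      refine LipschitzOnWith.of_dist_le_mul fun x hx y hy => ?_
      rw [dist_eq_norm, Real.coe_toNNReal _ h0, Real.dist_eq]
      exact h2 y hy x hx
    refine ⟨hl, h0, ?_⟩
    rw [← restrict_Ioo_eq_restrict_Ioc]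
    filter_upwards [ae_restrict_mem measurableSet_Ioo] with s hs
    have := norm_deriv_le_of_lipschitzOn (isOpen_Ioo.mem_nhds hs) hl
    rwa [Real.coe_toNNReal _ h0] at this
  refine ⟨deriv E, ?_, ?_, fun t ht M h => (hbd t ht M h).2.2⟩
  · intro x hx
    have hx0 : (0:ℝ) ≤ x := hx
    refine ⟨Icc 0 (x + 1), ?_, ?_⟩
    · filter_upwards [self_mem_nhdsWithin, mem_nhdsWithin_of_mem_nhds (Iio_mem_nhds (lt_add_one x))]
        with z hz hz'
      exact ⟨hz, le_of_lt hz'⟩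
    · rw [integrableOn_Icc_iff_integrableOn_Ioc]
      obtain ⟨M, hM⟩ := hM (x + 1) (by linarith)
      refine Integrable.mono' (g := fun _ => c * M) (integrable_const _)
        (stronglyMeasurable_deriv E).aestronglyMeasurable (hbd _ (by linarith) M hM).2.2
  · intro φ h1 h2 h3
    have hφ1 : ContDiff ℝ 1 φ := h1.of_le (by exact_mod_cast le_top)
    have hdφ : ContDiff ℝ 1 (deriv φ) := by
      exact (contDiff_infty_iff_deriv.1 h1).2.of_le (by exact_mod_cast le_top)
    have hlip : ∀ T, 0 < T → ∃ C : ℝ≥0, LipschitzOnWith C E (Ioo 0 T) := by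
      intro T hT
      obtain ⟨M, hM⟩ := hM T hT
      exact ⟨_, (hbd T hT M hM).1⟩
    have hder : ∀ t, 0 < t → HasDerivAt (lconv k u) (E t) t := by
      intro t ht
      obtain ⟨M, hM⟩ := hM (t + 1) (by linarith)
      exact (hloc _ (by linarith) M hM).1 t ⟨ht, by linarith⟩
    have hcont : ContinuousOn E (Ioi 0) := by
      intro t ht
      obtain ⟨C, hC⟩ := hlip (t + 1) (by linarith [mem_Ioi.1 ht])
      exact (hC.continuousOn.continuousAt (Ioo_mem_nhds ht (by linarith))).continuousWithinAt
    rw [ibp_smooth hder hcont hdφ h2.deriv (tsupport_deriv_subset.trans h3),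
      ibp_lip hlip hφ1 h2 h3, neg_neg]

lemma smooth_ibp {k : ℝ → U →L[ℝ] Y} (hk : Continuous k)
    {u : ℝ → U} (hu : ContDiff ℝ (⊤ : ℕ∞) u) (hs : tsupport u ⊆ Ioi 0)
    {φ : ℝ → ℝ} (h1 : ContDiff ℝ (⊤ : ℕ∞) φ) (h2 : HasCompactSupport φ) (h3 : tsupport φ ⊆ Ioi 0) :
      ∫ t in Set.Ioi (0:ℝ), deriv (deriv φ) t • lconv k u t =
        ∫ t in Set.Ioi (0:ℝ), φ t • lconv k (deriv (deriv u)) t := by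
  have hφ1 : ContDiff ℝ 1 φ := h1.of_le (by exact_mod_cast le_top)
  have hdφ : ContDiff ℝ 1 (deriv φ) := by
    exact (contDiff_infty_iff_deriv.1 h1).2.of_le (by exact_mod_cast le_top)
  have hu1 : ContDiff ℝ 1 u := hu.of_le (by exact_mod_cast le_top)
  have hdu : ContDiff ℝ 1 (deriv u) := by
    exact (contDiff_infty_iff_deriv.1 hu).2.of_le (by exact_mod_cast le_top)
  have d1 := (lconv_deriv hk hu1 (test_zero hs)).2
  have d2 := (lconv_deriv hk hdu (test_zero (tsupport_deriv_subset.trans hs))).2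
  rw [ibp_smooth d1 (lconv_continuous hk hdu.continuous).continuousOn hdφ h2.deriv
    (tsupport_deriv_subset.trans h3),
    ibp_smooth d2 (lconv_continuous hk (hdu.continuous_deriv le_rfl)).continuousOn hφ1 h2 h3, neg_neg]

end Abs

section Sys
variable {U X Xm1 Y : Type*}
    [NormedAddCommGroup U] [NormedSpace ℂ U]
    [NormedAddCommGroup X] [NormedSpace ℂ X]
    [NormedAddCommGroup Xm1] [NormedSpace ℂ Xm1]
    [NormedAddCommGroup Y] [NormedSpace ℂ Y]

lemma semigroup_bdd [CompleteSpace X] (S : C0Semigroup X) (t : ℝ) :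
    ∃ C : ℝ, ∀ r ∈ Icc 0 t, ‖S.T r‖ ≤ C := by
  have : ∀ x : X, ∃ C, ∀ r : Icc (0:ℝ) t, ‖S.T r x‖ ≤ C := by
    intro x
    obtain ⟨C, hC⟩ := (isCompact_Icc (a := 0) (b := t)).exists_bound_of_continuousOn
      ((S.strongly_continuous x).mono Icc_subset_Ici_self)
    exact ⟨C, fun r => hC r r.2⟩
  obtain ⟨C, hC⟩ := banach_steinhaus this
  exact ⟨C, fun r hr => hC ⟨r, hr⟩⟩

/-- operator kernel `T(r) ρ` -/
noncomputable def semiK (S : C0Semigroup X) (ρ : U →L[ℂ] X) (r : ℝ) : U →L[ℝ] X :=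
  ((S.T (max r 0)).comp ρ).restrictScalars ℝ

lemma semiK_apply (S : C0Semigroup X) (ρ : U →L[ℂ] X) {r : ℝ} (hr : 0 ≤ r) (u : U) :
    semiK S ρ r u = S.T r (ρ u) := by simp [semiK, max_eq_left hr]

lemma semiK_cont [FiniteDimensional ℂ U] (S : C0Semigroup X) (ρ : U →L[ℂ] X) :
    Continuous (semiK S ρ) := by
  rw [continuous_clm_apply (𝕜 := ℝ)]
  intro u
  have := (S.strongly_continuous (ρ u)).comp_continuous (f := fun r : ℝ => max r 0)
    (by fun_prop) (fun r => le_max_right r 0)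
  exact this

namespace SystemNode
variable (sys : SystemNode U X Xm1 Y)

lemma am1_comm {t : ℝ} (ht : 0 ≤ t) (x : X) : sys.Sm1.T t (sys.Am1 x) = sys.Am1 (sys.S.T t x) := by
  have h0 := sys.generator x 0 le_rfl
  rw [sys.S.map_zero] at h0
  have h1 : HasDerivWithinAt (fun τ : ℝ => sys.Sm1.T t (sys.ι (sys.S.T τ x)))
      (sys.Sm1.T t (sys.Am1 x)) (Ici 0) 0 :=
    (((sys.Sm1.T t).restrictScalars ℝ).hasFDerivAt.comp_hasDerivWithinAt (0:ℝ) h0)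
  have h2 : HasDerivWithinAt (fun τ : ℝ => sys.ι (sys.S.T (t + τ) x))
      (sys.Am1 (sys.S.T t x)) (Ici 0) 0 := by
    have hg := sys.generator x t ht
    have hs : HasDerivWithinAt (fun τ : ℝ => t + τ) 1 (Ici 0) 0 :=
      ((hasDerivAt_id (0:ℝ)).const_add t).hasDerivWithinAt
    have := HasDerivWithinAt.scomp_of_eq (0:ℝ) hg hs
      (fun τ hτ => add_nonneg ht hτ) (by simp)
    simpa [Function.comp_def] using this
  have h3 : HasDerivWithinAt (fun τ : ℝ => sys.ι (sys.S.T (t + τ) x))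
      (sys.Sm1.T t (sys.Am1 x)) (Ici 0) 0 := by
    refine h1.congr (fun τ hτ => ?_) ?_
    · rw [sys.semigroup_compat t ht, sys.S.map_add t τ ht hτ]; rfl
    · rw [sys.semigroup_compat t ht, sys.S.map_add t 0 ht le_rfl]; rfl
  exact (uniqueDiffOn_Ici (0:ℝ) 0 self_mem_Ici).eq_deriv _ h3 h2

/-- the real number `β` -/
noncomputable def bR : ℝ := sys.S.growthBound + 1

lemma beta_smul {Z : Type*} [NormedAddCommGroup Z] [NormedSpace ℂ Z] (z : Z) :
    sys.betaPt • z = sys.bR • z := by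
  simp only [betaPt, bR]
  exact Complex.coe_smul _ z

lemma beta_re : sys.S.growthBound < sys.betaPt.re := by simp [betaPt]

/-- `(β - A)⁻¹ B` -/
noncomputable def rho : U →L[ℂ] X := (sys.R sys.betaPt).comp sys.B

lemma rho_eq (u : U) : sys.bR • sys.ι (sys.rho u) - sys.Am1 (sys.rho u) = sys.B u := by
  have := sys.R_right sys.betaPt sys.beta_re (sys.B u)
  rwa [beta_smul] at this

lemma R_iota_dom (x : X) : sys.Am1 (sys.R sys.betaPt (sys.ι x)) =
    sys.ι (sys.bR • sys.R sys.betaPt (sys.ι x) - x) := by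
  have := sys.R_right sys.betaPt sys.beta_re (sys.ι x)
  rw [beta_smul] at this
  rw [map_sub, ← ContinuousLinearMap.coe_restrictScalars' (R := ℝ) (f := sys.ι), map_smul]
  simp only [ContinuousLinearMap.coe_restrictScalars']
  rw [eq_sub_iff_add_eq, add_comm, ← eq_sub_iff_add_eq]
  exact this.symm

lemma exists_Ct : ∃ Ct : X →L[ℂ] Y, ∀ x, Ct x = sys.Cop (sys.R sys.betaPt (sys.ι x)) := by
  obtain ⟨M, hM⟩ := sys.Cop_bound
  have hdom : ∀ x : X, ∃ z : X, sys.Am1 (sys.R sys.betaPt (sys.ι x)) = sys.ι z :=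
    fun x => ⟨_, sys.R_iota_dom x⟩
  let f : X →ₗ[ℂ] Y :=
    { toFun := fun x => sys.Cop (sys.R sys.betaPt (sys.ι x))
      map_add' := fun x y => by
        rw [map_add, map_add, sys.Cop_add _ _ (hdom x) (hdom y)]
      map_smul' := fun a x => by
        rw [map_smul, map_smul, sys.Cop_smul _ _ (hdom x)]; rfl }
  let r := (sys.R sys.betaPt).comp sys.ι
  refine ⟨f.mkContinuous (|M| * (‖r‖ + (|sys.bR| * ‖r‖ + 1))) fun x => ?_, fun x => rfl⟩
  have h1 := hM _ _ (sys.R_iota_dom x)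
  have hr : ‖sys.R sys.betaPt (sys.ι x)‖ ≤ ‖r‖ * ‖x‖ := r.le_opNorm x
  have h2 : ‖sys.bR • sys.R sys.betaPt (sys.ι x) - x‖ ≤ |sys.bR| * (‖r‖ * ‖x‖) + ‖x‖ := by
    refine (norm_sub_le _ _).trans ?_
    rw [norm_smul, Real.norm_eq_abs]
    gcongr
  calc ‖f x‖ ≤ M * (‖sys.R sys.betaPt (sys.ι x)‖ + ‖sys.bR • sys.R sys.betaPt (sys.ι x) - x‖) := h1
    _ ≤ |M| * (‖sys.R sys.betaPt (sys.ι x)‖ + ‖sys.bR • sys.R sys.betaPt (sys.ι x) - x‖) := by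
      gcongr; exact le_abs_self M
    _ ≤ |M| * (‖r‖ * ‖x‖ + (|sys.bR| * (‖r‖ * ‖x‖) + ‖x‖)) := by gcongr
    _ = _ := by ring

/-- `C (β - A)⁻¹` -/
noncomputable def Ct : X →L[ℂ] Y := sys.exists_Ct.choose

lemma Ct_apply (x : X) : sys.Ct x = sys.Cop (sys.R sys.betaPt (sys.ι x)) :=
  sys.exists_Ct.choose_spec x

lemma CD_form {x z : X} {v : U} (h : sys.Am1 x + sys.B v = sys.ι z) :
    sys.CD x v = sys.Ct (sys.bR • x - z) + sys.G sys.betaPt v := by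
  rw [CD, Ct_apply]
  congr 2
  have h1 := sys.R_left sys.betaPt sys.beta_re x
  have e : sys.ι (sys.bR • x - z) = (sys.betaPt • sys.ι x - sys.Am1 x) - sys.B v := by
    rw [map_sub, ← h, ← beta_smul, map_smul]; abel
  rw [e, map_sub, h1]

lemma uniq [CompleteSpace Xm1] {z z' : ℝ → X}
    (hz : ∀ t ∈ Ici (0:ℝ), HasDerivWithinAt z (z' t) (Ici 0) t)
    (hA : ∀ t ∈ Ici (0:ℝ), sys.Am1 (z t) = sys.ι (z' t)) (h0 : z 0 = 0) :
    ∀ t, 0 ≤ t → z t = 0 := by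
  intro t ht
  obtain ⟨C, hC⟩ := semigroup_bdd sys.Sm1 t
  have hC0 : 0 ≤ C := (norm_nonneg _).trans (hC 0 ⟨le_rfl, ht⟩)
  have hιz : ∀ s ∈ Ici (0:ℝ), HasDerivWithinAt (fun s => sys.ι (z s)) (sys.ι (z' s)) (Ici 0) s :=
    fun s hs => ((sys.ι.restrictScalars ℝ).hasFDerivAt.comp_hasDerivWithinAt s (hz s hs))
  have hconst := constant_of_has_deriv_right_zero (a := 0) (b := t)
    (f := fun s => sys.Sm1.T (t - s) (sys.ι (z s))) ?_ ?_
  · have := hconst t ⟨ht, le_rfl⟩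
    simp only [sub_self, sys.Sm1.map_zero, h0, map_zero] at this
    exact sys.ι_injective (by simpa using this)
  · intro s hs
    have c1 : ContinuousWithinAt (fun s => sys.ι (z s)) (Icc 0 t) s :=
      ((hιz s hs.1).continuousWithinAt).mono Icc_subset_Ici_self
    have c2 : ContinuousWithinAt (fun s' => sys.Sm1.T (t - s') (sys.ι (z s))) (Icc 0 t) s :=
      (sys.Sm1.strongly_continuous (sys.ι (z s)) (t - s) (by simpa using hs.2)).comp
        (f := fun s' => t - s') (by fun_prop) (fun s' hs' => by simpa using hs'.2)
    have c3 : Filter.Tendsto (fun s' => sys.Sm1.T (t - s') (sys.ι (z s') - sys.ι (z s)))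
        (𝓝[Icc 0 t] s) (𝓝 0) := by
      have hlim : Filter.Tendsto (fun s' => C * ‖sys.ι (z s') - sys.ι (z s)‖) (𝓝[Icc 0 t] s) (𝓝 0) := by
        have c0 : ContinuousWithinAt (fun _ : ℝ => sys.ι (z s)) (Icc 0 t) s :=
          continuousWithinAt_const
        have := (c1.sub c0).norm.const_mul C
        simpa [ContinuousWithinAt] using this
      refine squeeze_zero_norm' ?_ hlim
      filter_upwards [self_mem_nhdsWithin] with s' hs'
      exact (ContinuousLinearMap.le_opNorm _ _).trans (by
        gcongr; exact hC _ ⟨by linarith [hs'.2], by linarith [hs'.1]⟩)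
    have c4 := c3.add c2
    rw [zero_add] at c4
    refine c4.congr (fun s' => ?_)
    rw [map_sub, sub_add_cancel]
  · intro s hs
    have hs0 : (0:ℝ) ≤ s := hs.1
    have d1 : HasDerivWithinAt (fun s' => sys.ι (z s')) (sys.ι (z' s)) (Ici s) s :=
      (hιz s hs0).mono (Ici_subset_Ici.2 hs0)
    have d2 : HasDerivWithinAt (fun s' => sys.ι (sys.S.T (s' - s) (z s))) (sys.ι (z' s)) (Ici s) s := by
      have hg := sys.generator (z s) 0 le_rfl
      rw [sys.S.map_zero] at hg
      have hsh : HasDerivWithinAt (fun τ : ℝ => τ - s) 1 (Ici s) s :=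
        ((hasDerivAt_id s).sub_const s).hasDerivWithinAt
      have := HasDerivWithinAt.scomp_of_eq s hg hsh
        (fun τ hτ => by simpa using hτ) (by simp)
      rw [← hA s hs0]
      simpa [Function.comp_def] using this
    have d3 := d1.sub d2
    rw [sub_self] at d3
    rw [hasDerivWithinAt_iff_isLittleO] at d3 ⊢
    refine Asymptotics.IsBigO.trans_isLittleO ?_ d3
    refine Asymptotics.IsBigO.of_bound C ?_
    filter_upwards [self_mem_nhdsWithin, mem_nhdsWithin_of_mem_nhds (Iio_mem_nhds hs.2)] with s' h1 h2
    have h1' : s ≤ s' := h1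
    have h2' : s' < t := h2
    have e : sys.Sm1.T (t - s) (sys.ι (z s)) =
        sys.Sm1.T (t - s') (sys.ι (sys.S.T (s' - s) (z s))) := by
      have hm := sys.Sm1.map_add (t - s') (s' - s) (by linarith) (by linarith)
      rw [← sys.semigroup_compat (s' - s) (by linarith), show t - s = (t - s') + (s' - s) by ring, hm]
      rfl
    simp only [smul_zero, sub_zero, Pi.sub_apply, sub_self, sys.S.map_zero, ContinuousLinearMap.id_apply]
    rw [e, ← map_sub]
    refine (ContinuousLinearMap.le_opNorm _ _).trans ?_
    gcongr
    exact hC _ ⟨by linarith, by linarith⟩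

end SystemNode
end Sys

section Sys2
variable {U X Xm1 Y : Type*}
    [NormedAddCommGroup U] [NormedSpace ℂ U]
    [NormedAddCommGroup X] [NormedSpace ℂ X]
    [NormedAddCommGroup Xm1] [NormedSpace ℂ Xm1]
    [NormedAddCommGroup Y] [NormedSpace ℂ Y]

lemma ii_comp {E F : Type*} [NormedAddCommGroup E] [NormedSpace ℝ E] [NormedAddCommGroup F]
    [NormedSpace ℝ F] (L : E →L[ℝ] F) {f : ℝ → E} {a b : ℝ} (hf : IntervalIntegrable f volume a b) :
    IntervalIntegrable (fun s => L (f s)) volume a b :=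
  ⟨L.integrable_comp hf.1, L.integrable_comp hf.2⟩

lemma ii_smul {E : Type*} [NormedAddCommGroup E] [NormedSpace ℝ E] (c : ℝ)
    {f : ℝ → E} {a b : ℝ} (hf : IntervalIntegrable f volume a b) :
    IntervalIntegrable (fun s => c • f s) volume a b := hf.smul c

lemma ii_sub {E : Type*} [NormedAddCommGroup E] [NormedSpace ℝ E]
    {f g : ℝ → E} {a b : ℝ} (hf : IntervalIntegrable f volume a b)
    (hg : IntervalIntegrable g volume a b) :
    IntervalIntegrable (fun s => f s - g s) volume a b := hf.sub hg

/-- double integral -/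
noncomputable def dbl (v : ℝ → U) (t : ℝ) : U := ∫ s in (0:ℝ)..t, (t - s) • v s

lemma dbl_int {v : ℝ → U} {t : ℝ} (hv : IntervalIntegrable v volume 0 t) :
    IntervalIntegrable (fun s => (t - s) • v s) volume 0 t :=
  hv.continuousOn_smul (by fun_prop)

namespace SystemNode
variable (sys : SystemNode U X Xm1 Y)

/-- real version of `ι` -/
noncomputable def iR : X →L[ℝ] Xm1 := sys.ι.restrictScalars ℝ
/-- real version of `A` -/
noncomputable def AR : X →L[ℝ] Xm1 := sys.Am1.restrictScalars ℝ
/-- real version of `B` -/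
noncomputable def BR : U →L[ℝ] Xm1 := sys.B.restrictScalars ℝ
/-- real version of `C(β-A)⁻¹` -/
noncomputable def CtR : X →L[ℝ] Y := sys.Ct.restrictScalars ℝ
/-- real version of `G(β)` -/
noncomputable def GR : U →L[ℝ] Y := (sys.G sys.betaPt).restrictScalars ℝ
/-- real version of `rho` -/
noncomputable def rR : U →L[ℝ] X := sys.rho.restrictScalars ℝ

/-- kernel -/
noncomputable def kP : ℝ → U →L[ℝ] X := semiK sys.S sys.rho
/-- kernel -/
noncomputable def kQ : ℝ → U →L[ℝ] Xm1 := semiK sys.Sm1 sys.B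
/-- kernel -/
noncomputable def J1 (r : ℝ) : U →L[ℝ] X := ∫ s in (0:ℝ)..r, sys.kP s
/-- kernel -/
noncomputable def J2 (r : ℝ) : U →L[ℝ] X := ∫ s in (0:ℝ)..r, sys.J1 s
/-- kernel -/
noncomputable def kV (r : ℝ) : U →L[ℝ] X := sys.bR • sys.J1 r - sys.kP r + sys.rR
/-- kernel -/
noncomputable def kW (r : ℝ) : U →L[ℝ] X := sys.bR • sys.J2 r - sys.J1 r + r • sys.rR
/-- kernel -/
noncomputable def kk (r : ℝ) : U →L[ℝ] Y :=
  sys.CtR.comp (sys.bR • sys.kW r - sys.kV r) + r • sys.GR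

variable [FiniteDimensional ℂ U]

lemma kP_cont : Continuous sys.kP := semiK_cont _ _
lemma kQ_cont : Continuous sys.kQ := semiK_cont _ _
lemma J1_cont : Continuous sys.J1 :=
  intervalIntegral.continuous_primitive (fun a b => sys.kP_cont.intervalIntegrable a b) 0
lemma J2_cont : Continuous sys.J2 :=
  intervalIntegral.continuous_primitive (fun a b => sys.J1_cont.intervalIntegrable a b) 0
lemma kV_cont : Continuous sys.kV := by
  unfold kV
  have := sys.J1_cont
  have := sys.kP_cont
  fun_prop
lemma kW_cont : Continuous sys.kW := by
  unfold kW
  have := sys.J1_cont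
  have := sys.J2_cont
  fun_prop
lemma kk_cont : Continuous sys.kk := by
  unfold kk
  have := sys.kV_cont
  have := sys.kW_cont
  fun_prop

lemma J1_apply (r : ℝ) (u : U) : sys.J1 r u = ∫ s in (0:ℝ)..r, sys.kP s u :=
  ContinuousLinearMap.intervalIntegral_apply (sys.kP_cont.intervalIntegrable _ _) u
lemma J2_apply (r : ℝ) (u : U) : sys.J2 r u = ∫ s in (0:ℝ)..r, sys.J1 s u :=
  ContinuousLinearMap.intervalIntegral_apply (sys.J1_cont.intervalIntegrable _ _) u

lemma kP_zero (u : U) : sys.kP 0 u = sys.rR u := by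
  rw [kP, semiK_apply _ _ le_rfl, sys.S.map_zero]; rfl

variable [CompleteSpace X] [CompleteSpace Xm1]

lemma int_A1 {r : ℝ} (hr : 0 ≤ r) (u : U) :
    ∫ s in (0:ℝ)..r, sys.AR (sys.kP s u) = sys.iR (sys.kP r u) - sys.iR (sys.rR u) := by
  rw [← sys.kP_zero u]
  have hc : Continuous fun s => sys.kP s u := sys.kP_cont.clm_apply continuous_const
  refine intervalIntegral.integral_eq_sub_of_hasDeriv_right (f := fun s => sys.iR (sys.kP s u))
    (sys.iR.continuous.comp hc).continuousOn ?_
    ((sys.AR.continuous.comp hc).intervalIntegrable _ _)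
  intro x hx
  rw [min_eq_left hr] at hx
  have hx0 : 0 ≤ x := hx.1.le
  have h := (sys.generator (sys.rho u) x hx0).mono
    (show Ioi x ⊆ Ici 0 from fun y hy => hx0.trans (le_of_lt hy))
  have e : sys.AR (sys.kP x u) = sys.Am1 (sys.S.T x (sys.rho u)) := by
    rw [kP, semiK_apply _ _ hx0]; rfl
  rw [e]
  refine h.congr (fun y hy => ?_) ?_
  · rw [kP, semiK_apply _ _ (hx0.trans (le_of_lt hy))]; rfl
  · rw [kP, semiK_apply _ _ hx0]; rfl

lemma A1 {r : ℝ} (hr : 0 ≤ r) (u : U) :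
    sys.AR (sys.J1 r u) = sys.iR (sys.kP r u) - sys.iR (sys.rR u) := by
  rw [← sys.int_A1 hr, J1_apply, ContinuousLinearMap.intervalIntegral_comp_comm]
  exact (sys.kP_cont.clm_apply continuous_const).intervalIntegrable _ _

lemma A2 {r : ℝ} (hr : 0 ≤ r) (u : U) :
    sys.AR (sys.J2 r u) = sys.iR (sys.J1 r u) - r • sys.iR (sys.rR u) := by
  rw [J2_apply, ← ContinuousLinearMap.intervalIntegral_comp_comm _
    ((sys.J1_cont.clm_apply continuous_const).intervalIntegrable _ _)]
  have hP : Continuous fun s => sys.kP s u := sys.kP_cont.clm_apply continuous_const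
  rw [intervalIntegral.integral_congr (g := fun s => sys.iR (sys.kP s u) - sys.iR (sys.rR u))
    (fun s hs => by rw [uIcc_of_le hr] at hs; exact sys.A1 hs.1 u),
    intervalIntegral.integral_sub (ii_comp sys.iR (hP.intervalIntegrable 0 r)) (by simp),
    ContinuousLinearMap.intervalIntegral_comp_comm _ (hP.intervalIntegrable _ _), ← J1_apply]
  simp

lemma A3 {r : ℝ} (hr : 0 ≤ r) (u : U) :
    sys.kQ r u = sys.bR • sys.iR (sys.kP r u) - sys.AR (sys.kP r u) := by
  rw [kQ, kP, semiK_apply _ _ hr, semiK_apply _ _ hr, ← sys.rho_eq u, map_sub, sys.am1_comm hr,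
    ← beta_smul, map_smul, sys.semigroup_compat r hr, beta_smul]
  rfl

lemma V1 {r : ℝ} (hr : 0 ≤ r) : sys.iR.comp (sys.kV r) = ∫ s in (0:ℝ)..r, sys.kQ s := by
  ext u
  rw [ContinuousLinearMap.intervalIntegral_apply (sys.kQ_cont.intervalIntegrable _ _)]
  have hP : Continuous fun s => sys.kP s u := sys.kP_cont.clm_apply continuous_const
  rw [intervalIntegral.integral_congr
    (g := fun s => sys.bR • sys.iR (sys.kP s u) - sys.AR (sys.kP s u))
    (fun s hs => by rw [uIcc_of_le hr] at hs; exact sys.A3 hs.1 u),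
    intervalIntegral.integral_sub (ii_smul sys.bR (ii_comp sys.iR (hP.intervalIntegrable 0 r)))
      (ii_comp sys.AR (hP.intervalIntegrable 0 r)), sys.int_A1 hr,
    intervalIntegral.integral_smul,
    ContinuousLinearMap.intervalIntegral_comp_comm _ (hP.intervalIntegrable _ _), ← J1_apply]
  simp only [kV, ContinuousLinearMap.comp_apply, _root_.add_apply,
    _root_.sub_apply, _root_.smul_apply, map_add, map_sub, map_smul]
  abel

lemma W1 (r : ℝ) : sys.kW r = ∫ s in (0:ℝ)..r, sys.kV s := by
  unfold kV
  have h1 := sys.J1_cont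
  have h2 := sys.kP_cont
  rw [intervalIntegral.integral_add (ii_sub (ii_smul sys.bR (h1.intervalIntegrable 0 r)) (h2.intervalIntegrable 0 r)) (by simp),
    intervalIntegral.integral_sub (ii_smul sys.bR (h1.intervalIntegrable 0 r))
      (h2.intervalIntegrable _ _), intervalIntegral.integral_smul]
  simp [kW, J1, J2]

lemma W2 {r : ℝ} (hr : 0 ≤ r) (u : U) :
    sys.AR (sys.kW r u) + r • sys.BR u = sys.iR (sys.kV r u) := by
  have hB : sys.BR u = sys.bR • sys.iR (sys.rR u) - sys.AR (sys.rR u) := (sys.rho_eq u).symm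
  rw [hB]
  simp only [kV, kW, _root_.add_apply,
    _root_.sub_apply, _root_.smul_apply, map_add, map_sub, map_smul,
    sys.A1 hr, sys.A2 hr]
  module

lemma AB_eq {v : ℝ → U} {t : ℝ} (ht : 0 ≤ t) (hv : IntervalIntegrable v volume 0 t) :
    sys.Am1 (lconv sys.kW v t) + sys.B (dbl v t) = sys.ι (lconv sys.kV v t) := by
  have : CompleteSpace U := FiniteDimensional.complete ℂ U
  change sys.AR _ + sys.BR _ = sys.iR _
  have i1 := lconv_integrable sys.kW_cont hv
  have i2 := lconv_integrable sys.kV_cont hv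
  have i3 := dbl_int hv
  unfold lconv dbl
  rw [← ContinuousLinearMap.intervalIntegral_comp_comm _ i1,
    ← ContinuousLinearMap.intervalIntegral_comp_comm _ i2,
    ← ContinuousLinearMap.intervalIntegral_comp_comm _ i3,
    ← intervalIntegral.integral_add (ii_comp sys.AR i1) (ii_comp sys.BR i3)]
  refine intervalIntegral.integral_congr fun s hs => ?_
  rw [uIcc_of_le ht] at hs
  simp only [map_smul]
  exact sys.W2 (by linarith [hs.2]) _

lemma CD_eq [CompleteSpace Y] {v : ℝ → U} {t : ℝ} (ht : 0 ≤ t) (hv : IntervalIntegrable v volume 0 t) :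
    sys.CD (lconv sys.kW v t) (dbl v t) = lconv sys.kk v t := by
  have : CompleteSpace U := FiniteDimensional.complete ℂ U
  rw [sys.CD_form (sys.AB_eq ht hv)]
  change sys.CtR _ + sys.GR _ = _
  have i1 := lconv_integrable sys.kW_cont hv
  have i2 := lconv_integrable sys.kV_cont hv
  have i3 := dbl_int hv
  unfold lconv dbl
  rw [← intervalIntegral.integral_smul, ← intervalIntegral.integral_sub (ii_smul sys.bR i1) i2,
    ← ContinuousLinearMap.intervalIntegral_comp_comm _ (ii_sub (ii_smul sys.bR i1) i2),
    ← ContinuousLinearMap.intervalIntegral_comp_comm _ i3,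
    ← intervalIntegral.integral_add (ii_comp sys.CtR (ii_sub (ii_smul sys.bR i1) i2))
      (ii_comp sys.GR i3)]
  refine intervalIntegral.integral_congr fun s hs => ?_
  simp [kk]

lemma iota_W {v : ℝ → U} {xs : ℝ → Xm1} {t : ℝ} (ht : 0 ≤ t)
    (hv : IntervalIntegrable v volume 0 t) (hc : ContinuousOn xs (Ici 0))
    (hx : ∀ s, 0 ≤ s → xs s = lconv sys.kQ v s) :
    sys.ι (lconv sys.kW v t) = ∫ s in (0:ℝ)..t, (t - s) • xs s := by
  have hxi : IntervalIntegrable xs volume 0 t :=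
    (hc.mono (by rw [uIcc_of_le ht]; exact Icc_subset_Ici_self)).intervalIntegrable
  rw [prim_prim ht hxi]
  change sys.iR _ = _
  have hcV : Continuous fun r => sys.iR.comp (sys.kV r) := by
    have := sys.kV_cont
    fun_prop
  have e : sys.iR (lconv sys.kW v t) = lconv (fun r => sys.iR.comp (sys.kW r)) v t := by
    unfold lconv
    rw [← ContinuousLinearMap.intervalIntegral_comp_comm _ (lconv_integrable sys.kW_cont hv)]
    rfl
  rw [e, lconv_prim_left (a := fun r => sys.iR.comp (sys.kV r)) hcV ?_ ht hv]
  · refine intervalIntegral.integral_congr fun s hs => ?_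
    rw [uIcc_of_le ht] at hs
    rw [lconv_prim_left sys.kQ_cont (fun r hr => sys.V1 hr) hs.1 (hv.mono_set (by
      rw [uIcc_of_le ht, uIcc_of_le hs.1]; exact Icc_subset_Icc_right hs.2))]
    refine intervalIntegral.integral_congr fun σ hσ => ?_
    rw [uIcc_of_le hs.1] at hσ
    exact (hx σ hσ.1).symm
  · intro r _
    rw [W1]
    exact (ContinuousLinearMap.intervalIntegral_comp_comm
      (ContinuousLinearMap.compL ℝ U X Xm1 sys.iR) (sys.kV_cont.intervalIntegrable 0 r)).symm

end SystemNode
end Sys2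

section Sys3
variable {U X Xm1 Y : Type*}
    [NormedAddCommGroup U] [NormedSpace ℂ U] [FiniteDimensional ℂ U]
    [NormedAddCommGroup X] [NormedSpace ℂ X] [CompleteSpace X]
    [NormedAddCommGroup Xm1] [NormedSpace ℂ Xm1] [CompleteSpace Xm1]
    [NormedAddCommGroup Y] [NormedSpace ℂ Y] [FiniteDimensional ℂ Y]

namespace SystemNode
variable (sys : SystemNode U X Xm1 Y)

lemma dd_cont {u : ℝ → U} (hu : ContDiff ℝ (⊤ : ℕ∞) u) : Continuous (deriv (deriv u)) := by
  have hdu : ContDiff ℝ 1 (deriv u) :=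
    (contDiff_infty_iff_deriv.1 hu).2.of_le (by exact_mod_cast le_top)
  exact hdu.continuous_deriv le_rfl

lemma dbl_dd {u : ℝ → U} (hu : ContDiff ℝ (⊤ : ℕ∞) u) (hs : tsupport u ⊆ Ioi 0) {t : ℝ}
    (ht : 0 ≤ t) : dbl (deriv (deriv u)) t = u t := by
  have : CompleteSpace U := FiniteDimensional.complete ℂ U
  have hu1 : ContDiff ℝ 1 u := hu.of_le (by exact_mod_cast le_top)
  have hdu : ContDiff ℝ 1 (deriv u) :=
    (contDiff_infty_iff_deriv.1 hu).2.of_le (by exact_mod_cast le_top)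
  have h0 : u 0 = 0 := image_eq_zero_of_notMem_tsupport fun h => lt_irrefl (0:ℝ) (hs h)
  have h0' : deriv u 0 = 0 := image_eq_zero_of_notMem_tsupport fun h =>
    lt_irrefl (0:ℝ) (hs (closure_minimal (support_deriv_subset) (isClosed_tsupport u) h))
  rw [dbl, prim_prim ht ((dd_cont hu).intervalIntegrable _ _)]
  have e : ∀ s, ∫ r in (0:ℝ)..s, deriv (deriv u) r = deriv u s := by
    intro s
    rw [intervalIntegral.integral_deriv_eq_sub (fun x _ => hdu.differentiable one_ne_zero x)
      ((dd_cont hu).intervalIntegrable _ _), h0', sub_zero]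
  simp_rw [e]
  rw [intervalIntegral.integral_deriv_eq_sub (fun x _ => hu1.differentiable one_ne_zero x)
      (hdu.continuous.intervalIntegrable _ _), h0, sub_zero]

/-- the canonical classical solution -/
lemma classical_exists {u : ℝ → U} (hu : ContDiff ℝ (⊤ : ℕ∞) u) (hs : tsupport u ⊆ Ioi 0) :
    sys.IsClassicalSolution u (lconv sys.kW (deriv (deriv u))) (lconv sys.kk (deriv (deriv u))) := by
  have : CompleteSpace Y := FiniteDimensional.complete ℂ Y
  have hd := dd_cont hu
  have hcV := lconv_continuous sys.kV_cont hd
  refine ⟨hu.continuous.continuousOn, (lconv_continuous sys.kk_cont hd).continuousOn,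
    ⟨lconv sys.kV (deriv (deriv u)), hcV.continuousOn, ?_, ?_⟩, ?_⟩
  · intro t ht
    have h1 : HasDerivWithinAt (fun t => ∫ s in (0:ℝ)..t, lconv sys.kV (deriv (deriv u)) s)
        (lconv sys.kV (deriv (deriv u)) t) (Ici 0) t :=
      (intervalIntegral.integral_hasDerivAt_right (hcV.intervalIntegrable _ _)
        (hcV.stronglyMeasurableAtFilter _ _) hcV.continuousAt).hasDerivWithinAt
    have e : ∀ s ∈ Ici (0:ℝ), lconv sys.kW (deriv (deriv u)) s =
        ∫ s in (0:ℝ)..s, lconv sys.kV (deriv (deriv u)) s := fun s hs =>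
      lconv_prim_left sys.kV_cont (fun r _ => sys.W1 r) hs (hd.intervalIntegrable _ _)
    exact h1.congr e (e t ht)
  · intro t ht
    have := sys.AB_eq ht (hd.intervalIntegrable 0 t)
    rwa [dbl_dd hu hs ht] at this
  · intro t ht
    have := sys.CD_eq ht (hd.intervalIntegrable 0 t)
    rw [dbl_dd hu hs ht] at this
    exact this.symm

lemma classical_unique {u : ℝ → U} {x x2 : ℝ → X} {y y2 : ℝ → Y}
    (h : sys.IsClassicalSolution u x y) (h2 : sys.IsClassicalSolution u x2 y2)
    (h0 : x 0 = 0) (h02 : x2 0 = 0) {t : ℝ} (ht : 0 ≤ t) : y t = y2 t := by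
  obtain ⟨-, -, ⟨x', -, a1, a2⟩, a3⟩ := h
  obtain ⟨-, -, ⟨x2', -, b1, b2⟩, b3⟩ := h2
  have := sys.uniq (z := fun t => x t - x2 t) (z' := fun t => x' t - x2' t)
    (fun t ht => (a1 t ht).sub (b1 t ht))
    (fun t ht => by
      rw [map_sub, map_sub, ← a2 t ht, ← b2 t ht]; abel) (by simp [h0, h02]) t ht
  rw [a3 t ht, b3 t ht, sub_eq_zero.1 this]

lemma c_to_l (h : sys.CInfBIBOStable) : sys.LInfBIBOStable := by
  have : CompleteSpace Y := FiniteDimensional.complete ℂ Y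
  have : CompleteSpace U := FiniteDimensional.complete ℂ U
  have : FiniteDimensional ℝ U := FiniteDimensional.complexToReal U
  have : FiniteDimensional ℝ Y := FiniteDimensional.complexToReal Y
  obtain ⟨c, hc, H⟩ := h
  refine ⟨c, hc, fun u xs hx hM => ?_⟩
  obtain ⟨hu, hxc, hx⟩ := hx
  have hui : ∀ T : ℝ, IntegrableOn u (Icc 0 T) := fun T =>
    hu.integrableOn_compact_subset Icc_subset_Ici_self isCompact_Icc
  have hui' : ∀ T : ℝ, 0 ≤ T → IntervalIntegrable u volume 0 T := fun T hT =>
    (intervalIntegrable_iff_integrableOn_Icc_of_le hT).2 (hui T)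
  obtain ⟨y, y1, y2, y3⟩ := abs_main sys.kk_cont hc (fun v v1 v2 v3 M hM t ht =>
    H v _ _ (sys.classical_exists v1 v3) (by simp [lconv]) v1 v2 v3 M hM t ht)
    (u := u) (fun T _ => (hui T).mono_set Ioc_subset_Icc_self) hM
  refine ⟨y, ⟨y1, lconv sys.kW u, dbl u, ?_, fun t _ => rfl, ?_, ?_⟩, y3⟩
  · intro t ht
    refine sys.iota_W ht (hui' t ht) hxc fun s hs => ?_
    rw [(hx s hs).2, map_zero, map_zero, zero_add]
    refine intervalIntegral.integral_congr fun σ hσ => ?_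
    rw [uIcc_of_le hs] at hσ
    rw [kQ, semiK_apply _ _ (by linarith [hσ.2])]
  · intro t ht
    exact ⟨_, sys.AB_eq ht (hui' t ht)⟩
  · intro φ h1 h2 h3
    rw [← y2 φ h1 h2 h3]
    refine setIntegral_congr_fun measurableSet_Ioi fun t ht => ?_
    simp only [sys.CD_eq (le_of_lt ht) (hui' t (le_of_lt ht))]

lemma l_to_c (h : sys.LInfBIBOStable) : sys.CInfBIBOStable := by
  have : CompleteSpace Y := FiniteDimensional.complete ℂ Y
  have : CompleteSpace U := FiniteDimensional.complete ℂ U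
  have : FiniteDimensional ℝ U := FiniteDimensional.complexToReal U
  have : FiniteDimensional ℝ Y := FiniteDimensional.complexToReal Y
  obtain ⟨c, hc, H⟩ := h
  refine ⟨c, hc, fun u x y hcl hx0 hu hu2 hu3 M hM t ht => ?_⟩
  rw [sys.classical_unique hcl (sys.classical_exists hu hu3) hx0 (by simp [lconv]) ht]
  have hM0 : 0 ≤ M := (norm_nonneg _).trans (hM 0)
  have huc := hu.continuous
  have hQ : ∀ t : ℝ, 0 ≤ t → ∀ s ∈ uIcc 0 t, sys.kQ (t - s) (u s) =
      sys.Sm1.T (t - s) (sys.B (u s)) := by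
    intro t ht s hs
    rw [uIcc_of_le ht] at hs
    rw [kQ, semiK_apply _ _ (by linarith [hs.2])]
  have hmild : sys.IsMildState 0 u (lconv sys.kQ u) := by
    refine ⟨huc.locallyIntegrable.locallyIntegrableOn _,
      (lconv_continuous sys.kQ_cont huc).continuousOn, fun t ht => ⟨?_, ?_⟩⟩
    · refine (lconv_integrable sys.kQ_cont (huc.intervalIntegrable 0 t)).congr ?_
      intro s hs
      exact hQ t ht s (uIoc_subset_uIcc hs)
    · rw [map_zero, map_zero, zero_add]
      exact intervalIntegral.integral_congr fun s hs => hQ t ht s hs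
  obtain ⟨y', ⟨l1, K, L, k1, k2, k3, k4⟩, hb⟩ := H u _ hmild
    (fun t _ => ⟨M, Filter.Eventually.of_forall hM⟩)
  have hcd : ∀ t ∈ Ioi (0:ℝ), sys.CD (K t) (L t) = lconv sys.kk u t := by
    intro t ht
    have ht' : 0 ≤ t := le_of_lt ht
    have hui := huc.intervalIntegrable (μ := volume) 0 t
    rw [← sys.CD_eq ht' hui]
    congr 1
    · apply sys.ι_injective
      change sys.ι _ = sys.ι _
      rw [k1 t ht', sys.iota_W ht' hui hmild.2.1 (fun s _ => rfl)]
    · exact k2 t ht'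
  set g := lconv sys.kk (deriv (deriv u)) with hg
  have hgc : Continuous g := lconv_continuous sys.kk_cont (dd_cont hu)
  have hloc : LocallyIntegrableOn (fun t => g t - y' t) (Ioi 0) :=
    (hgc.locallyIntegrable.locallyIntegrableOn _).sub (l1.mono_set Ioi_subset_Ici_self)
  have hae : ∀ᵐ t : ℝ, t ∈ Ioi (0:ℝ) → g t - y' t = 0 := by
    refine isOpen_Ioi.ae_eq_zero_of_integral_contDiff_smul_eq_zero hloc ?_
    intro φ h1 h2 h3
    have e1 := k4 φ h1 h2 h3
    rw [setIntegral_congr_fun (g := fun t => deriv (deriv φ) t • lconv sys.kk u t)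
      measurableSet_Ioi (fun t ht => by simp only [hcd t ht]),
      smooth_ibp sys.kk_cont hu hu3 h1 h2 h3] at e1
    have hz : ∀ t, t ∉ Ioi (0:ℝ) → φ t = 0 := fun t ht =>
      image_eq_zero_of_notMem_tsupport fun h => ht (h3 h)
    rw [← setIntegral_eq_integral_of_forall_compl_eq_zero (s := Ioi 0)
      (fun t ht => by rw [hz t ht, zero_smul])]
    have i1 : IntegrableOn (fun t => φ t • g t) (Ioi 0) :=
      ((h1.continuous.smul hgc).integrable_of_hasCompactSupport h2.smul_right).integrableOn
    have i2 : IntegrableOn (fun t => φ t • y' t) (Ioi 0) := by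
      have a1 : IntegrableOn y' (tsupport φ) :=
        l1.integrableOn_compact_subset (h3.trans Ioi_subset_Ici_self) h2
      have a2 : IntegrableOn (fun t => φ t • y' t) (tsupport φ) :=
        a1.continuousOn_smul h1.continuous.continuousOn h2
      have a3 : Integrable (fun t => φ t • y' t) :=
        (integrableOn_iff_integrable_of_support_subset (fun t ht => subset_tsupport φ (by
          intro h0; apply ht; simp [h0]))).1 a2
      exact a3.integrableOn
    simp only [smul_sub]
    rw [integral_sub i1 i2, sub_eq_zero]
    exact e1
  have hpos : ∀ t, 0 < t → ‖g t‖ ≤ c * M := by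
    intro t ht
    by_contra! hlt
    have hopen : IsOpen {s | c * M < ‖g s‖} := isOpen_lt continuous_const hgc.norm
    have hO : IsOpen ({s | c * M < ‖g s‖} ∩ Ioo 0 (t + 1)) := hopen.inter isOpen_Ioo
    have hne : ({s | c * M < ‖g s‖} ∩ Ioo 0 (t + 1)).Nonempty := ⟨t, hlt, ht, by linarith⟩
    have hp := hO.measure_pos volume hne
    have hb' := hb (t + 1) (by linarith) M (Filter.Eventually.of_forall hM)
    rw [ae_restrict_iff' measurableSet_Ioc] at hb'
    have hboth : ∀ᵐ s : ℝ, s ∉ ({s | c * M < ‖g s‖} ∩ Ioo 0 (t + 1)) := by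
      filter_upwards [hae, hb'] with s h1 h2 h3
      have h4 := h2 ⟨h3.2.1, h3.2.2.le⟩
      rw [← sub_eq_zero.1 (h1 h3.2.1)] at h4
      exact absurd h3.1 (not_lt.2 h4)
    have := measure_eq_zero_iff_ae_notMem.2 hboth
    exact hp.ne' this
  rcases ht.eq_or_lt with rfl | ht
  · have : g 0 = 0 := by simp [hg, lconv]
    rw [this, norm_zero]; positivity
  · exact hpos t ht

end SystemNode
end Sys3

/-- Theorem 3.5: a system node with finite-dimensional input and output
spaces is `C^∞`-BIBO stable if and only if it is `L^∞`-BIBO stable. -/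
theorem cInfBIBO_iff_lInfBIBO
    {U X Xm1 Y : Type*}
    [NormedAddCommGroup U] [NormedSpace ℂ U] [FiniteDimensional ℂ U]
    [NormedAddCommGroup X] [NormedSpace ℂ X] [CompleteSpace X]
    [NormedAddCommGroup Xm1] [NormedSpace ℂ Xm1] [CompleteSpace Xm1]
    [NormedAddCommGroup Y] [NormedSpace ℂ Y] [FiniteDimensional ℂ Y]
    (sys : SystemNode U X Xm1 Y) :
    sys.CInfBIBOStable ↔ sys.LInfBIBOStable := by
  exact ⟨sys.c_to_l, sys.l_to_c⟩
end

section
/- Let Σ(A,B,C,G) be a system node. Assume there exists a Borel measure h of bounded total variation on [0,∞) with values in the d_Y × d_U complex matrices such that the Laplace transform ĥ equals G on the half-plane C_{ω(T)}. Then Σ(A,B,C,G) is C^∞-BIBO stable; moreover, every classical solution (u,x,y) with x(0)=0 and u ∈ C_c^∞((0,∞),U) satisfies y = h ∗ u and ‖y‖_{L^∞([0,∞),Y)} ≤ ‖h‖_M ‖u‖_{L^∞([0,∞),U)}. -/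
open MeasureTheory Set
open scoped ENNReal NNReal Topology

open FourierTransform in
theorem aux_fourier_inj {Y : Type*} [NormedAddCommGroup Y] [NormedSpace ℂ Y] [CompleteSpace Y]
    (φ : ℝ → Y) (hφ : Integrable φ)
    (h0 : ∀ ξ : ℝ, ∫ t : ℝ, Complex.exp (-(ξ * t) * Complex.I) • φ t = 0) :
    ∀ᵐ t, φ t = 0 := by
  apply ae_eq_zero_of_integral_contDiff_smul_eq_zero hφ.locallyIntegrable
  intro g hg hgc
  have hF : ∀ w, VectorFourier.fourierIntegral Real.fourierChar volume (innerₗ ℝ).flip φ w = 0 := by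
    intro w
    have := h0 (2 * Real.pi * w)
    rw [flip_innerₗ]
    rw [← this]
    have h2 := Real.fourier_real_eq_integral_exp_smul φ w
    rw [Real.fourier_eq] at h2
    simp only [VectorFourier.fourierIntegral]
    refine Eq.trans h2 ?_
    congr 1
    ext t
    congr 2
    push_cast
    ring
  set G : ℝ → ℂ := fun t => (g t : ℂ) with hGdef
  have hG1 : ContDiff ℝ (⊤ : ℕ∞) G := Complex.ofRealCLM.contDiff.comp hg
  have hG2 : HasCompactSupport G := hgc.comp_left (g := fun r : ℝ => (r : ℂ)) (by simp)
  let S := hG2.toSchwartzMap hG1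
  let S0 := 𝓕⁻ S
  have hS : 𝓕 (S0 : ℝ → ℂ) = G := by
    rw [← SchwartzMap.fourier_coe]
    simp only [S0, FourierInvPair.fourier_fourierInv_eq]
    rfl
  have key := VectorFourier.integral_fourierIntegral_smul_eq_flip (L := innerₗ ℝ) (μ := volume)
    (ν := volume) (e := Real.fourierChar) (f := (S0 : ℝ → ℂ)) (g := φ)
    Real.continuous_fourierChar continuous_inner S0.integrable hφ
  simp only [hF, smul_zero, integral_zero] at key
  rw [← key]
  congr 1
  ext t
  have : VectorFourier.fourierIntegral Real.fourierChar volume (innerₗ ℝ) (S0 : ℝ → ℂ) t = G t := by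
    rw [← hS]; rfl
  rw [this]
  simp [hGdef]

section aux
variable {X : Type*} [NormedAddCommGroup X] [NormedSpace ℂ X]

theorem aux_exp_bound [CompleteSpace X] (S : C0Semigroup X) :
    ∃ M w : ℝ, 0 ≤ M ∧ ∀ t : ℝ, 0 ≤ t → ‖S.T t‖ ≤ M * Real.exp (w * t) := by
  have hb : ∃ C, ∀ i : Icc (0:ℝ) 1, ‖S.T i‖ ≤ C := by
    apply banach_steinhaus
    intro x
    obtain ⟨C, hC⟩ := isCompact_Icc.exists_bound_of_continuousOn
      ((S.strongly_continuous x).mono (Icc_subset_Ici_self : Icc (0:ℝ) 1 ⊆ Ici 0))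
    exact ⟨C, fun i => hC i i.2⟩
  obtain ⟨C, hC⟩ := hb
  have hC' : ∀ t, 0 ≤ t → t ≤ 1 → ‖S.T t‖ ≤ Real.exp (|C|) := fun t h0 h1 =>
    (hC ⟨t, h0, h1⟩).trans ((le_abs_self C).trans (by linarith [Real.add_one_le_exp |C|]))
  refine ⟨Real.exp |C|, |C|, by positivity, ?_⟩
  have key : ∀ n : ℕ, ∀ t : ℝ, n ≤ t → t ≤ n + 1 →
      ‖S.T t‖ ≤ Real.exp |C| * Real.exp (|C| * n) := by
    intro n
    induction n with
    | zero => intro t h0 h1; simpa using hC' t (by simpa using h0) (by simpa using h1)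
    | succ n ih =>
      intro t h0 h1
      push_cast at h0 h1
      have hn : (0:ℝ) ≤ n := n.cast_nonneg
      have := S.map_add (t - 1) 1 (by linarith) zero_le_one
      rw [sub_add_cancel] at this
      rw [this]
      refine (ContinuousLinearMap.opNorm_comp_le _ _).trans ?_
      have h3 := ih (t - 1) (by linarith) (by linarith)
      have h4 := hC' 1 zero_le_one le_rfl
      calc _ ≤ (Real.exp |C| * Real.exp (|C| * n)) * Real.exp |C| := by gcongr
        _ = _ := by rw [← Real.exp_add, ← Real.exp_add, ← Real.exp_add]; push_cast; ring_nf
  intro t ht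
  refine (key ⌊t⌋₊ t (Nat.floor_le ht) (Nat.lt_floor_add_one t).le).trans ?_
  have := Nat.floor_le ht
  gcongr

end aux

section aux2
variable {U X Xm1 Y : Type*}
  [NormedAddCommGroup U] [NormedSpace ℂ U]
  [NormedAddCommGroup X] [NormedSpace ℂ X]
  [NormedAddCommGroup Xm1] [NormedSpace ℂ Xm1]
  [NormedAddCommGroup Y] [NormedSpace ℂ Y]

theorem aux_comm (sys : SystemNode U X Xm1 Y) (x z : X) (hxz : sys.Am1 x = sys.ι z)
    (t : ℝ) (ht : 0 ≤ t) : sys.Am1 (sys.S.T t x) = sys.ι (sys.S.T t z) := by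
  have h1 := (sys.generator x t ht).mono (Ici_subset_Ici.2 ht)
  have h2 := sys.generator x 0 le_rfl
  rw [sys.S.map_zero] at h2
  have h3 : HasDerivWithinAt (fun τ : ℝ => sys.Sm1.T t (sys.ι (sys.S.T τ x)))
      (sys.Sm1.T t (sys.Am1 x)) (Ici 0) (t - t) := by
    rw [sub_self]
    exact ((sys.Sm1.T t).restrictScalars ℝ).hasFDerivAt.comp_hasDerivWithinAt 0 h2
  have h4 : HasDerivWithinAt (fun τ : ℝ => τ - t) 1 (Ici t) t :=
    ((hasDerivAt_id t).sub_const t).hasDerivWithinAt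
  have h5 := HasDerivWithinAt.scomp (h := fun τ : ℝ => τ - t) t h3 h4
    (fun τ hτ => sub_nonneg.2 (mem_Ici.1 hτ))
  have h6 : HasDerivWithinAt (fun τ : ℝ => sys.ι (sys.S.T τ x)) (sys.Sm1.T t (sys.Am1 x))
      (Ici t) t := by
    rw [one_smul] at h5
    refine h5.congr_of_mem (fun τ hτ => ?_) self_mem_Ici
    have hτ' : t ≤ τ := hτ
    have := sys.S.map_add t (τ - t) ht (by linarith)
    rw [add_sub_cancel] at this
    simp only [Function.comp, this]
    rw [sys.semigroup_compat t ht]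
    rfl
  have := (uniqueDiffWithinAt_Ici t).eq_deriv _ h1 h6
  rw [this, hxz, sys.semigroup_compat t ht]

theorem aux_deriv [CompleteSpace X] [CompleteSpace Xm1] (sys : SystemNode U X Xm1 Y) (x z : X)
    (hxz : sys.Am1 x = sys.ι z) (t : ℝ) (ht : 0 ≤ t) :
    HasDerivWithinAt (fun τ : ℝ => sys.S.T τ x) (sys.S.T t z) (Ici 0) t := by
  have hc := sys.S.strongly_continuous z
  -- continuous extension
  let f : ℝ → X := fun r => sys.S.T (max r 0) z
  have hf : Continuous f := by
    have : Continuous fun r : ℝ => (⟨max r 0, mem_Ici.2 (le_max_right _ _)⟩ : Ici (0:ℝ)) := by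
      fun_prop
    exact (continuousOn_iff_continuous_domRestrict.1 hc).comp this
  have hint : ∀ r, 0 ≤ r → sys.S.T r x = x + ∫ q in (0:ℝ)..r, f q := by
    intro r hr
    apply sys.ι_injective
    have h1 : ∫ q in (0:ℝ)..r, sys.ι (f q) = sys.ι (sys.S.T r x) - sys.ι (sys.S.T 0 x) := by
      apply intervalIntegral.integral_eq_sub_of_hasDeriv_right_of_le hr
        (f := fun q => sys.ι (sys.S.T q x))
      · exact sys.ι.continuous.comp_continuousOn
          ((sys.S.strongly_continuous x).mono Icc_subset_Ici_self)
      · intro q hq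
        have := sys.generator x q hq.1.le
        rw [aux_comm sys x z hxz q hq.1.le] at this
        have hfq : f q = sys.S.T q z := by simp [f, max_eq_left hq.1.le]
        rw [hfq]
        exact this.mono (fun p hp => hq.1.le.trans (le_of_lt hp))
      · exact (sys.ι.continuous.comp hf).intervalIntegrable _ _
    have h2 := sys.ι.intervalIntegral_comp_comm (hf.intervalIntegrable (μ := volume) 0 r)
    simp only [map_add]
    rw [← h2, h1, sys.S.map_zero]
    simp
  have h3 : HasDerivAt (fun r => x + ∫ q in (0:ℝ)..r, f q) (f t) t :=
    (hf.integral_hasStrictDerivAt 0 t).hasDerivAt.const_add x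
  have hft : f t = sys.S.T t z := by simp [f, max_eq_left ht]
  rw [← hft]
  exact h3.hasDerivWithinAt.congr_of_mem (fun r hr => hint r hr) ht

/-- The bounded operator `C (β - A)⁻¹` on `X`. -/
theorem aux_K (sys : SystemNode U X Xm1 Y) (b : ℂ) (hb : sys.S.growthBound < b.re) :
    ∃ K : X →L[ℂ] Y, ∀ x z : X, sys.Am1 x = sys.ι z → sys.Cop x = K (b • x - z) := by
  have hdom : ∀ v, sys.Am1 (sys.R b (sys.ι v)) = sys.ι (b • sys.R b (sys.ι v) - v) := by
    intro v
    have := sys.R_right b hb (sys.ι v)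
    rw [map_sub, map_smul]
    rw [sub_eq_iff_eq_add] at this
    rw [this]
    simp
  obtain ⟨M, hM⟩ := sys.Cop_bound
  let L : X →ₗ[ℂ] Y :=
    { toFun := fun v => sys.Cop (sys.R b (sys.ι v))
      map_add' := fun v w => by
        rw [map_add, map_add]
        exact sys.Cop_add _ _ ⟨_, hdom v⟩ ⟨_, hdom w⟩
      map_smul' := fun a v => by
        rw [map_smul, map_smul]
        exact sys.Cop_smul _ _ ⟨_, hdom v⟩ }
  let Q : X →L[ℂ] X := (sys.R b).comp sys.ι
  refine ⟨L.mkContinuous (|M| * (‖Q‖ + (‖b‖ * ‖Q‖ + 1))) (fun v => ?_), fun x z hxz => ?_⟩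
  · refine (hM _ _ (hdom v)).trans ?_
    have h1 : ‖sys.R b (sys.ι v)‖ ≤ ‖Q‖ * ‖v‖ := Q.le_opNorm v
    have h2 : ‖b • sys.R b (sys.ι v) - v‖ ≤ ‖b‖ * (‖Q‖ * ‖v‖) + ‖v‖ := by
      refine (norm_sub_le _ _).trans ?_
      rw [norm_smul]
      gcongr
    calc _ ≤ |M| * (‖Q‖ * ‖v‖ + (‖b‖ * (‖Q‖ * ‖v‖) + ‖v‖)) := by
          gcongr
          exact le_abs_self M
      _ = _ := by ring
  · have := sys.R_left b hb x
    simp only [LinearMap.mkContinuous_apply, L, LinearMap.coe_mk, AddHom.coe_mk]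
    rw [map_sub, map_smul, ← hxz, this]

end aux2

section aux3
variable {U X Xm1 Y : Type*}
  [NormedAddCommGroup U] [NormedSpace ℂ U]
  [NormedAddCommGroup X] [NormedSpace ℂ X]
  [NormedAddCommGroup Xm1] [NormedSpace ℂ Xm1]
  [NormedAddCommGroup Y] [NormedSpace ℂ Y]

theorem aux_u_zero (u : ℝ → U) (hs : tsupport u ⊆ Ioi 0) (t : ℝ) (ht : t ≤ 0) : u t = 0 := by
  by_contra hne
  have := hs (subset_tsupport u hne)
  exact absurd (mem_Ioi.1 this) (not_lt.2 ht)

theorem aux_nonneg_ae (h : BVMeasure U Y) : ∀ᵐ r ∂h.μ, 0 ≤ r := by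
  rw [ae_iff]
  convert h.supported using 2
  ext r; simp

theorem aux_conv_eq (h : BVMeasure U Y) (u : ℝ → U) (hs : tsupport u ⊆ Ioi 0) (t : ℝ) :
    h.conv u t = ∫ r, h.g r (u (t - r)) ∂h.μ := by
  unfold BVMeasure.conv
  rw [← integral_indicator measurableSet_Icc]
  apply integral_congr_ae
  filter_upwards [aux_nonneg_ae h] with r hr
  by_cases hrt : r ≤ t
  · rw [indicator_of_mem (show r ∈ Icc 0 t from ⟨hr, hrt⟩)]
  · rw [indicator_of_notMem (fun h' => hrt h'.2), aux_u_zero u hs _ (by linarith), map_zero]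

theorem aux_conv_meas (h : BVMeasure U Y) (u : ℝ → U) (hu : Continuous u) (t : ℝ) :
    AEStronglyMeasurable (fun r => h.g r (u (t - r))) h.μ :=
  (ContinuousLinearMap.apply ℂ Y).flip.aestronglyMeasurable_comp₂ h.g_meas
    (by fun_prop : Continuous fun r => u (t - r)).aestronglyMeasurable

theorem aux_conv_bound (h : BVMeasure U Y) (u : ℝ → U) (hs : tsupport u ⊆ Ioi 0) (M : ℝ)
    (hM : ∀ t, ‖u t‖ ≤ M) (t : ℝ) : ‖h.conv u t‖ ≤ h.var * M := by
  rw [aux_conv_eq h u hs]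
  have := h.finite
  refine (norm_integral_le_of_norm_le_const (C := M) ?_).trans (le_of_eq ?_)
  · filter_upwards [h.g_norm] with r hr
    refine ((h.g r).le_opNorm _).trans ?_
    rw [hr, one_mul]; exact hM _
  · rw [mul_comm]; rfl

theorem aux_conv_cont (h : BVMeasure U Y) (u : ℝ → U) (hu : Continuous u)
    (hc : HasCompactSupport u) (hs : tsupport u ⊆ Ioi 0) : Continuous (h.conv u) := by
  have := h.finite
  obtain ⟨M, hM⟩ := hc.exists_bound_of_continuous hu
  rw [show h.conv u = fun t => ∫ r, h.g r (u (t - r)) ∂h.μ from funext (aux_conv_eq h u hs)]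
  refine continuous_of_dominated (bound := fun _ => M) (fun t => aux_conv_meas h u hu t) ?_
    (integrable_const M) ?_
  · intro t
    filter_upwards [h.g_norm] with r hr
    refine ((h.g r).le_opNorm _).trans ?_
    rw [hr, one_mul]; exact hM _
  · filter_upwards with r
    fun_prop

theorem aux_conv_laplace [CompleteSpace U] [CompleteSpace Y]
    (h : BVMeasure U Y) (u : ℝ → U) (hu : Continuous u)
    (hc : HasCompactSupport u) (hs : tsupport u ⊆ Ioi 0) (s : ℂ) (hre : 0 ≤ s.re) :
    Integrable (fun t : ℝ => Complex.exp (-(s * t)) • h.conv u t) ∧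
    ∫ t : ℝ, Complex.exp (-(s * t)) • h.conv u t =
      h.laplace s (∫ t : ℝ, Complex.exp (-(s * t)) • u t) := by
  have := h.finite
  have hint : Integrable (fun t : ℝ => Complex.exp (-(s * t)) • u t) :=
    (by fun_prop : Continuous fun t : ℝ => Complex.exp (-(s * t)) • u t).integrable_of_hasCompactSupport
      (hc.smul_left (f := fun t : ℝ => Complex.exp (-(s * t))))
  let F : ℝ → ℝ → Y := fun r t => Complex.exp (-(s * t)) • h.g r (u (t - r))
  have hshift : ∀ r t : ℝ, F r t = Complex.exp (-(s * r)) •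
      h.g r (Complex.exp (-(s * (t - r : ℝ))) • u (t - r)) := by
    intro r t
    simp only [F]
    rw [map_smul, smul_smul, ← Complex.exp_add]
    congr 2
    push_cast; ring
  have hFr : ∀ r, Integrable (F r) := by
    intro r
    rw [show F r = _ from funext (hshift r)]
    exact (((h.g r).integrable_comp hint).comp_sub_right r).smul (Complex.exp (-(s * r)))
  have hFint : ∀ r, ∫ t, F r t = Complex.exp (-(s * r)) •
      h.g r (∫ t : ℝ, Complex.exp (-(s * t)) • u t) := by
    intro r
    simp_rw [hshift r]
    rw [integral_smul, integral_sub_right_eq_self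
      (fun t : ℝ => h.g r (Complex.exp (-(s * t)) • u t)) r, (h.g r).integral_comp_comm hint]
  have hmeas : AEStronglyMeasurable (Function.uncurry F) (h.μ.prod volume) := by
    have h1 : AEStronglyMeasurable (fun p : ℝ × ℝ => h.g p.1) (h.μ.prod volume) :=
      h.g_meas.comp_fst
    have h2 : Continuous fun p : ℝ × ℝ => u (p.2 - p.1) := by fun_prop
    have h3 : Continuous fun p : ℝ × ℝ => Complex.exp (-(s * p.2)) := by fun_prop
    exact h3.aestronglyMeasurable.smul ((ContinuousLinearMap.apply ℂ Y).flip.aestronglyMeasurable_comp₂ h1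
      h2.aestronglyMeasurable)
  have hF : Integrable (Function.uncurry F) (h.μ.prod volume) := by
    rw [integrable_prod_iff hmeas]
    refine ⟨Filter.Eventually.of_forall hFr, ?_⟩
    refine Integrable.of_bound (C := ∫ t : ℝ, ‖Complex.exp (-(s * t)) • u t‖)
      hmeas.norm.integral_prod_right' ?_
    filter_upwards [aux_nonneg_ae h, h.g_norm] with r hr hg
    simp only [Function.uncurry]
    rw [Real.norm_of_nonneg (integral_nonneg fun _ => norm_nonneg _)]
    rw [← integral_sub_right_eq_self (fun t : ℝ => ‖Complex.exp (-(s * t)) • u t‖) r]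
    refine integral_mono (hFr r).norm (hint.norm.comp_sub_right r) ?_
    intro t
    simp only
    rw [hshift, norm_smul]
    have h1 : ‖Complex.exp (-(s * r))‖ ≤ 1 := by
      rw [Complex.norm_exp]
      simp
      positivity
    have h2 := (h.g r).le_opNorm (Complex.exp (-(s * (t - r : ℝ))) • u (t - r))
    rw [hg, one_mul] at h2
    calc _ ≤ 1 * _ := mul_le_mul h1 h2 (norm_nonneg _) zero_le_one
      _ = _ := one_mul _
  have heq : (fun t : ℝ => Complex.exp (-(s * t)) • h.conv u t) = fun t => ∫ r, F r t ∂h.μ := by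
    ext t
    rw [aux_conv_eq h u hs, ← integral_smul]
  rw [heq]
  refine ⟨hF.integral_prod_right, ?_⟩
  rw [← integral_integral_swap hF]
  simp_rw [hFint]
  rfl

theorem aux_sol_laplace [CompleteSpace U] [CompleteSpace X] [CompleteSpace Xm1] [CompleteSpace Y]
    (sys : SystemNode U X Xm1 Y) (u : ℝ → U) (hu : Continuous u)
    (hc : HasCompactSupport u) (hs : tsupport u ⊆ Ioi 0)
    (xt xd : ℝ → X) (hxd : ContinuousOn xd (Ici 0))
    (hder : ∀ t, 0 ≤ t → HasDerivWithinAt xt (xd t) (Ici 0) t)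
    (heq : ∀ t, 0 ≤ t → sys.Am1 (xt t) + sys.B (u t) = sys.ι (xd t))
    (hx0 : xt 0 = 0) (C w : ℝ) (hb1 : ∀ t, 0 ≤ t → ‖xt t‖ ≤ C * Real.exp (w * t))
    (hb2 : ∀ t, 0 ≤ t → ‖xd t‖ ≤ C * Real.exp (w * t))
    (b : ℂ) (hb : sys.S.growthBound < b.re) (K : X →L[ℂ] Y)
    (hK : ∀ x z : X, sys.Am1 x = sys.ι z → sys.Cop x = K (b • x - z))
    (s : ℂ) (hs1 : sys.S.growthBound < s.re) (hs2 : w < s.re) :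
    IntegrableOn (fun t : ℝ => Complex.exp (-(s * t)) •
      (K (b • xt t - xd t) + sys.G b (u t))) (Ioi 0) ∧
    ∫ t in Ioi (0:ℝ), Complex.exp (-(s * t)) • (K (b • xt t - xd t) + sys.G b (u t)) =
      sys.G s (∫ t : ℝ, Complex.exp (-(s * t)) • u t) := by
  have hxc : ContinuousOn xt (Ici 0) := fun t ht => (hder t ht).continuousWithinAt
  have hec : Continuous fun t : ℝ => Complex.exp (-(s * t)) := by fun_prop
  have hnorm : ∀ t : ℝ, ‖Complex.exp (-(s * t))‖ = Real.exp (-(s.re * t)) := by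
    intro t; rw [Complex.norm_exp]; simp
  have hprod : ∀ t : ℝ, Real.exp (-(s.re * t)) * (C * Real.exp (w * t)) =
      C * Real.exp (-(s.re - w) * t) := by
    intro t
    rw [mul_left_comm, ← Real.exp_add]; ring_nf
  have hexpint : IntegrableOn (fun t => C * Real.exp (-(s.re - w) * t)) (Ioi 0) :=
    (exp_neg_integrableOn_Ioi 0 (by linarith)).const_mul C
  have hI : ∀ f : ℝ → X, ContinuousOn f (Ici 0) → (∀ t, 0 ≤ t → ‖f t‖ ≤ C * Real.exp (w * t)) →
      IntegrableOn (fun t : ℝ => Complex.exp (-(s * t)) • f t) (Ioi 0) := by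
    intro f hf hbf
    refine Integrable.mono' hexpint ?_ ?_
    · exact ((hec.continuousOn.smul hf).mono Ioi_subset_Ici_self).aestronglyMeasurable
        measurableSet_Ioi
    · rw [ae_restrict_iff' measurableSet_Ioi]
      filter_upwards with t ht
      rw [norm_smul, hnorm, ← hprod]
      gcongr
      exact hbf t (le_of_lt ht)
  have hI1 := hI xt hxc hb1
  have hI2 := hI xd hxd hb2
  have hIs : ∀ a : ℂ, IntegrableOn (fun t : ℝ => a • (Complex.exp (-(s * t)) • xt t)) (Ioi 0) :=
    fun a => hI1.smul a
  have hIu' : Integrable (fun t : ℝ => Complex.exp (-(s * t)) • u t) :=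
    (by fun_prop : Continuous fun t : ℝ => Complex.exp (-(s * t)) • u t).integrable_of_hasCompactSupport
      (hc.smul_left (f := fun t : ℝ => Complex.exp (-(s * t))))
  have hIu : IntegrableOn (fun t : ℝ => Complex.exp (-(s * t)) • u t) (Ioi 0) :=
    hIu'.integrableOn
  have hu0 : ∫ t : ℝ, Complex.exp (-(s * t)) • u t =
      ∫ t in Ioi (0:ℝ), Complex.exp (-(s * t)) • u t := by
    symm
    apply setIntegral_eq_integral_of_forall_compl_eq_zero
    intro t ht
    rw [aux_u_zero u hs t (not_lt.1 ht), smul_zero]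
  rw [hu0]
  set v := ∫ t in Ioi (0:ℝ), Complex.exp (-(s * t)) • u t with hv
  set p := ∫ t in Ioi (0:ℝ), Complex.exp (-(s * t)) • xt t with hp
  set q := ∫ t in Ioi (0:ℝ), Complex.exp (-(s * t)) • xd t with hq
  have hqp : q = s • p := by
    have hd : ∀ t ∈ Ioi (0:ℝ), HasDerivAt (fun t : ℝ => Complex.exp (-(s * t)) • xt t)
        (Complex.exp (-(s * t)) • xd t - s • (Complex.exp (-(s * t)) • xt t)) t := by
      intro t ht
      have h1 : HasDerivAt xt (xd t) t := (hder t (le_of_lt ht)).hasDerivAt (Ici_mem_nhds ht)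
      have h2 : HasDerivAt (fun t : ℝ => Complex.exp (-(s * t)))
          (Complex.exp (-(s * t)) * (-(s * 1))) t :=
        (((Complex.ofRealCLM.hasDerivAt (x := t)).const_mul s).neg).cexp
      have h3 := h2.smul h1
      have h4 : Complex.exp (-(s * t)) • xd t - s • (Complex.exp (-(s * t)) • xt t) =
          Complex.exp (-(s * t)) • xd t + (Complex.exp (-(s * t)) * (-(s * 1))) • xt t := by
        module
      rw [h4]
      exact h3
    have hlim : Filter.Tendsto (fun t : ℝ => Complex.exp (-(s * t)) • xt t) Filter.atTop (𝓝 0) := by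
      have hl : Filter.Tendsto (fun t : ℝ => C * Real.exp (-(s.re - w) * t)) Filter.atTop (𝓝 0) := by
        rw [← mul_zero C]
        refine Filter.Tendsto.const_mul C (Real.tendsto_exp_atBot.comp ?_)
        exact Filter.tendsto_id.const_mul_atTop_of_neg (by linarith)
      refine squeeze_zero_norm' ?_ hl
      filter_upwards [Filter.eventually_ge_atTop 0] with t ht
      rw [norm_smul, hnorm, ← hprod]
      gcongr
      exact hb1 t ht
    have := integral_Ioi_of_hasDerivAt_of_tendsto
      ((hec.continuousOn.smul hxc) 0 self_mem_Ici) hd (hI2.sub (hIs s)) hlim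
    rw [integral_sub hI2 (hIs s)] at this
    rw [integral_smul, Pi.smul_apply', hx0, smul_zero, sub_zero] at this
    exact sub_eq_zero.1 this
  have hAB : sys.Am1 p + sys.B v = sys.ι q := by
    rw [hp, hv, hq, ← sys.Am1.integral_comp_comm hI1, ← sys.B.integral_comp_comm hIu,
      ← sys.ι.integral_comp_comm hI2,
      ← integral_add (sys.Am1.integrable_comp hI1) (sys.B.integrable_comp hIu)]
    refine setIntegral_congr_fun measurableSet_Ioi fun t ht => ?_
    simp only [map_smul, ← heq t (le_of_lt ht), smul_add]
  have hpR : p = sys.R s (sys.B v) := by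
    have := sys.R_left s hs1 p
    rw [← this]
    congr 1
    rw [← map_smul, ← hqp, ← hAB]; abel
  have hdom : sys.Am1 (p - sys.R b (sys.B v)) = sys.ι (q - b • sys.R b (sys.B v)) := by
    have := sys.R_right b hb (sys.B v)
    rw [map_sub, map_sub, ← hAB, map_smul]
    nth_rewrite 2 [← this]
    abel
  have hout : K (b • p - q) + sys.G b v = sys.G s v := by
    have h1 := hK _ _ hdom
    have h2 := sys.G_shift s b hs1 hb v
    rw [← hpR, h1] at h2
    refine Eq.symm (sub_eq_iff_eq_add.1 (h2.trans ?_))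
    congr 1
    module
  have hfun : (fun t : ℝ => Complex.exp (-(s * t)) • (K (b • xt t - xd t) + sys.G b (u t))) =
      fun t : ℝ => K (b • (Complex.exp (-(s * t)) • xt t) - Complex.exp (-(s * t)) • xd t) +
        sys.G b (Complex.exp (-(s * t)) • u t) := by
    ext t
    simp only [map_sub, map_smul, smul_add, smul_sub]
    rw [smul_comm]
  have hJ : IntegrableOn (fun t : ℝ => b • (Complex.exp (-(s * t)) • xt t) -
      Complex.exp (-(s * t)) • xd t) (Ioi 0) := (hIs b).sub hI2
  have hJ1 := K.integrable_comp hJ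
  have hJ2 := (sys.G b).integrable_comp hIu
  rw [hfun]
  refine ⟨hJ1.add hJ2, ?_⟩
  rw [integral_add hJ1 hJ2, K.integral_comp_comm hJ, (sys.G b).integral_comp_comm hIu, ← hout,
    integral_sub (hIs b) hI2, integral_smul]

end aux3

section aux4
variable {U X Xm1 Y : Type*}
  [NormedAddCommGroup U] [NormedSpace ℂ U]
  [NormedAddCommGroup X] [NormedSpace ℂ X]
  [NormedAddCommGroup Xm1] [NormedSpace ℂ Xm1]
  [NormedAddCommGroup Y] [NormedSpace ℂ Y]

theorem aux_shift_deriv {f : ℝ → X} {f' : X} {a t : ℝ}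
    (hf : HasDerivWithinAt f f' (Ici 0) (t - a)) :
    HasDerivWithinAt (fun r => f (r - a)) f' (Ici a) t := by
  have h4 : HasDerivWithinAt (fun r : ℝ => r - a) 1 (Ici a) t :=
    ((hasDerivAt_id t).sub_const a).hasDerivWithinAt
  have h5 := HasDerivWithinAt.scomp (h := fun r : ℝ => r - a) t hf h4
    (fun r hr => sub_nonneg.2 (mem_Ici.1 hr))
  rw [one_smul] at h5
  exact h5

theorem aux_glue [CompleteSpace X] [CompleteSpace Xm1]
    (sys : SystemNode U X Xm1 Y) (u : ℝ → U) (x x' : ℝ → X) (hx' : ContinuousOn x' (Ici 0))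
    (hder : ∀ t, 0 ≤ t → HasDerivWithinAt x (x' t) (Ici 0) t)
    (heq : ∀ t, 0 ≤ t → sys.Am1 (x t) + sys.B (u t) = sys.ι (x' t))
    (τ : ℝ) (hτ : 0 ≤ τ) (huτ : ∀ t, τ ≤ t → u t = 0) :
    ∃ (xt xd : ℝ → X) (C w : ℝ), ContinuousOn xd (Ici 0) ∧
      (∀ t, 0 ≤ t → HasDerivWithinAt xt (xd t) (Ici 0) t) ∧
      (∀ t, 0 ≤ t → sys.Am1 (xt t) + sys.B (u t) = sys.ι (xd t)) ∧
      (∀ t, 0 ≤ t → ‖xt t‖ ≤ C * Real.exp (w * t)) ∧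
      (∀ t, 0 ≤ t → ‖xd t‖ ≤ C * Real.exp (w * t)) ∧
      (∀ t, t ≤ τ → xt t = x t) ∧ (∀ t, t ≤ τ → xd t = x' t) := by
  obtain ⟨M, w, hM, hMw⟩ := aux_exp_bound sys.S
  have hA : sys.Am1 (x τ) = sys.ι (x' τ) := by
    have := heq τ hτ
    rwa [huτ τ le_rfl, map_zero, add_zero] at this
  have hT0 : ∀ v, sys.S.T (τ - τ) v = v := by
    intro v; rw [sub_self, sys.S.map_zero]; rfl
  let gl : (ℝ → X) → ℝ → X := fun f t => if t ≤ τ then f t else sys.S.T (t - τ) (f τ)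
  have gl1 : ∀ f t, t ≤ τ → gl f t = f t := fun f t ht => if_pos ht
  have gl2 : ∀ f t, τ ≤ t → gl f t = sys.S.T (t - τ) (f τ) := by
    intro f t ht
    rcases ht.eq_or_lt with rfl | h
    · rw [gl1 _ _ le_rfl, hT0]
    · exact if_neg (not_le.2 h)
  have hset : Ici (0:ℝ) = Icc 0 τ ∪ Ici τ := (Icc_union_Ici_eq_Ici hτ).symm
  have hcont : ∀ f, ContinuousOn f (Ici 0) → ContinuousOn (gl f) (Ici 0) := by
    intro f hf
    rw [hset]
    refine ContinuousOn.union_of_isClosed ?_ ?_ isClosed_Icc isClosed_Ici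
    · exact (hf.mono Icc_subset_Ici_self).congr fun t ht => gl1 f t ht.2
    · have : ContinuousOn (fun t => sys.S.T (t - τ) (f τ)) (Ici τ) :=
        (sys.S.strongly_continuous (f τ)).comp (f := fun t : ℝ => t - τ)
          (by fun_prop) (fun r hr => sub_nonneg.2 (mem_Ici.1 hr))
      exact this.congr fun t ht => gl2 f t ht
  have hxc : ContinuousOn x (Ici 0) := fun t ht => (hder t ht).continuousWithinAt
  have hbd : ∀ f, ContinuousOn f (Ici 0) → ∃ C, 0 ≤ C ∧
      ∀ t, 0 ≤ t → ‖gl f t‖ ≤ C * Real.exp (max w 0 * t) := by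
    intro f hf
    obtain ⟨C1, hC1⟩ := isCompact_Icc.exists_bound_of_continuousOn
      (hf.mono (Icc_subset_Ici_self : Icc (0:ℝ) τ ⊆ Ici 0))
    have hC10 : 0 ≤ C1 := (norm_nonneg _).trans (hC1 0 ⟨le_rfl, hτ⟩)
    refine ⟨C1 + M * ‖f τ‖, by positivity, fun t ht => ?_⟩
    have hw : 0 ≤ max w 0 := le_max_right _ _
    have h1 : 1 ≤ Real.exp (max w 0 * t) := Real.one_le_exp (by positivity)
    have hM2 : 0 ≤ M * ‖f τ‖ := by positivity
    rcases le_total t τ with h | h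
    · rw [gl1 f t h]
      have := hC1 t ⟨ht, h⟩
      nlinarith
    · rw [gl2 f t h]
      have h3 : 0 ≤ t - τ := by linarith
      have h2 : Real.exp (w * (t - τ)) ≤ Real.exp (max w 0 * t) := by
        apply Real.exp_le_exp.2
        calc w * (t - τ) ≤ max w 0 * (t - τ) := by gcongr; exact le_max_left _ _
          _ ≤ _ := by gcongr; linarith
      calc _ ≤ ‖sys.S.T (t - τ)‖ * ‖f τ‖ := (sys.S.T (t - τ)).le_opNorm _
        _ ≤ (M * Real.exp (w * (t - τ))) * ‖f τ‖ := by gcongr; exact hMw _ h3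
        _ ≤ (M * Real.exp (max w 0 * t)) * ‖f τ‖ := by gcongr
        _ ≤ _ := by nlinarith
  obtain ⟨C1, hC1, hb1⟩ := hbd x hxc
  obtain ⟨C2, hC2, hb2⟩ := hbd x' hx'
  refine ⟨gl x, gl x', C1 + C2, max w 0, hcont x' hx', ?_, ?_, ?_, ?_, gl1 x, gl1 x'⟩
  · intro t ht
    have hL : t ≤ τ → HasDerivWithinAt (gl x) (gl x' t) (Icc 0 τ) t := by
      intro h
      rw [gl1 x' t h]
      exact ((hder t ht).mono Icc_subset_Ici_self).congr_of_mem (fun r hr => gl1 x r hr.2) ⟨ht, h⟩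
    have hR : τ ≤ t → HasDerivWithinAt (gl x) (gl x' t) (Ici τ) t := by
      intro h
      rw [gl2 x' t h]
      exact (aux_shift_deriv (aux_deriv sys (x τ) (x' τ) hA (t - τ)
        (sub_nonneg.2 h))).congr_of_mem (fun r hr => gl2 x r hr) h
    rcases lt_trichotomy t τ with h | h | h
    · refine (hL h.le).mono_of_mem_nhdsWithin ?_
      rw [mem_nhdsWithin]
      exact ⟨Iio τ, isOpen_Iio, h, fun r hr => ⟨hr.2, le_of_lt hr.1⟩⟩
    · rw [hset]
      exact (hL h.le).union (hR h.ge)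
    · refine (hR h.le).mono_of_mem_nhdsWithin (mem_nhdsWithin_of_mem_nhds (Ici_mem_nhds h))
  · intro t ht
    rcases le_total t τ with h | h
    · rw [gl1 x t h, gl1 x' t h]; exact heq t ht
    · rw [gl2 x t h, gl2 x' t h, huτ t h, map_zero, add_zero]
      exact aux_comm sys _ _ hA _ (sub_nonneg.2 h)
  · intro t ht
    refine (hb1 t ht).trans ?_
    gcongr; linarith
  · intro t ht
    refine (hb2 t ht).trans ?_
    gcongr; linarith

theorem aux_eq_conv [CompleteSpace U] [CompleteSpace X] [CompleteSpace Xm1] [CompleteSpace Y]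
    (sys : SystemNode U X Xm1 Y) (h : BVMeasure U Y) (hG : LaplaceMatches sys h)
    (u : ℝ → U) (x : ℝ → X) (y : ℝ → Y) (hsol : sys.IsClassicalSolution u x y) (hx0 : x 0 = 0)
    (hu : Continuous u) (hc : HasCompactSupport u) (hs : tsupport u ⊆ Ioi 0)
    (t : ℝ) (ht : 0 ≤ t) : y t = h.conv u t := by
  obtain ⟨-, hyc, ⟨x', hx', hder, heq⟩, hy⟩ := hsol
  obtain ⟨N, hN⟩ := hc.isCompact.bddAbove
  set τ := max N t + 1 with hτdef
  have htτ : t < τ := by have := le_max_right N t; linarith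
  have hNτ : N < τ := by have := le_max_left N t; linarith
  have huτ : ∀ r, τ ≤ r → u r = 0 := by
    intro r hr
    by_contra hne
    have := hN (subset_tsupport u hne)
    linarith
  have hb : sys.S.growthBound < sys.betaPt.re := by simp [SystemNode.betaPt]
  obtain ⟨K, hK⟩ := aux_K sys sys.betaPt hb
  have hyK : ∀ r, 0 ≤ r → y r = K (sys.betaPt • x r - x' r) + sys.G sys.betaPt (u r) := by
    intro r hr
    rw [hy r hr, SystemNode.CD]
    congr 1
    have hd : sys.Am1 (x r - sys.R sys.betaPt (sys.B (u r))) =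
        sys.ι (x' r - sys.betaPt • sys.R sys.betaPt (sys.B (u r))) := by
      have := sys.R_right _ hb (sys.B (u r))
      rw [map_sub, map_sub, ← heq r hr, map_smul]
      nth_rewrite 2 [← this]
      abel
    rw [hK _ _ hd]
    congr 1
    module
  obtain ⟨xt, xd, C, w, hxd, hder', heq', hb1, hb2, e1, e2⟩ :=
    aux_glue sys u x x' hx' hder heq τ (ht.trans htτ.le) huτ
  set f : ℝ → Y := fun r => K (sys.betaPt • xt r - xd r) + sys.G sys.betaPt (u r) with hf
  set σ : ℝ := max (max sys.S.growthBound w) 0 + 1 with hσ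
  have hσ0 : 0 ≤ σ := by have := le_max_right (max sys.S.growthBound w) 0; linarith
  have hσ1 : sys.S.growthBound < σ := by
    have := le_max_left (max sys.S.growthBound w) 0
    have := le_max_left sys.S.growthBound w
    linarith
  have hσ2 : w < σ := by
    have := le_max_left (max sys.S.growthBound w) 0
    have := le_max_right sys.S.growthBound w
    linarith
  let d : ℝ → Y := fun r => (Ioi (0:ℝ)).indicator f r - h.conv u r
  have key : ∀ s : ℂ, s.re = σ → Integrable (fun r : ℝ => Complex.exp (-(s * r)) • d r) ∧
      ∫ r : ℝ, Complex.exp (-(s * r)) • d r = 0 := by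
    intro s hsσ
    obtain ⟨i1, j1⟩ := aux_sol_laplace sys u hu hc hs xt xd hxd hder' heq'
      (by rw [e1 0 (ht.trans htτ.le), hx0]) C w hb1 hb2 sys.betaPt hb K hK s
      (by rw [hsσ]; exact hσ1) (by rw [hsσ]; exact hσ2)
    obtain ⟨i2, j2⟩ := aux_conv_laplace h u hu hc hs s (by rw [hsσ]; exact hσ0)
    have hfun : (fun r : ℝ => Complex.exp (-(s * r)) • d r) = fun r : ℝ =>
        (Ioi (0:ℝ)).indicator (fun r : ℝ => Complex.exp (-(s * r)) • f r) r -
          Complex.exp (-(s * r)) • h.conv u r := by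
      ext r
      simp only [d, smul_sub]
      by_cases hr : r ∈ Ioi (0:ℝ)
      · simp [indicator_of_mem hr]
      · simp [indicator_of_notMem hr]
    have i1' := (integrable_indicator_iff measurableSet_Ioi).2 i1
    rw [hfun]
    refine ⟨i1'.sub i2, ?_⟩
    rw [integral_sub i1' i2, integral_indicator measurableSet_Ioi, j2, j1,
      hG s (by rw [hsσ]; exact hσ1) (by rw [hsσ]; exact hσ0), sub_self]
  have hae := aux_fourier_inj (fun r : ℝ => Complex.exp (-((σ : ℂ) * r)) • d r)
    (key σ (by simp)).1 (by
      intro ξ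
      have := (key (σ + ξ * Complex.I) (by simp)).2
      rw [← this]
      congr 1
      ext r
      rw [smul_smul, ← Complex.exp_add]
      congr 2
      ring)
  have hae' : y =ᵐ[volume.restrict (Ico 0 τ)] h.conv u := by
    rw [← restrict_Ioo_eq_restrict_Ico]
    rw [Filter.EventuallyEq, ae_restrict_iff' measurableSet_Ioo]
    filter_upwards [hae] with r hr hrI
    have h1 : d r = 0 := (smul_eq_zero.1 hr).resolve_left (Complex.exp_ne_zero _)
    have h2 := sub_eq_zero.1 h1
    rw [indicator_of_mem (mem_Ioi.2 hrI.1)] at h2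
    rw [← h2, hyK r hrI.1.le, hf]
    simp only [e1 r hrI.2.le, e2 r hrI.2.le]
  exact Measure.eqOn_Ico_of_ae_eq volume hae' (hyc.mono Ico_subset_Ici_self)
    (aux_conv_cont h u hu hc hs).continuousOn ⟨ht, htτ⟩

end aux4

/-- Proposition 3.6: if the transfer function of a system node is the
Laplace transform of a measure `h` of bounded total variation on `[0,∞)`, then the node
is `C^∞`-BIBO stable; moreover every classical solution with zero initial state and
smooth input compactly supported in `(0,∞)` satisfies `y = h ∗ u` and
`‖y‖_{L^∞} ≤ ‖h‖_M ‖u‖_{L^∞}`. -/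
theorem bvMeasure_implies_cInfBIBO
    {U X Xm1 Y : Type*}
    [NormedAddCommGroup U] [NormedSpace ℂ U] [FiniteDimensional ℂ U]
    [NormedAddCommGroup X] [NormedSpace ℂ X] [CompleteSpace X]
    [NormedAddCommGroup Xm1] [NormedSpace ℂ Xm1] [CompleteSpace Xm1]
    [NormedAddCommGroup Y] [NormedSpace ℂ Y] [FiniteDimensional ℂ Y]
    (sys : SystemNode U X Xm1 Y)
    (h : BVMeasure U Y) (hG : LaplaceMatches sys h) :
    sys.CInfBIBOStable ∧
    ∀ (u : ℝ → U) (x : ℝ → X) (y : ℝ → Y),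
      sys.IsClassicalSolution u x y → x 0 = 0 →
      ContDiff ℝ (⊤ : ℕ∞) u → HasCompactSupport u → tsupport u ⊆ Set.Ioi 0 →
      (∀ t : ℝ, 0 ≤ t → y t = h.conv u t) ∧
      (∀ M : ℝ, (∀ s : ℝ, ‖u s‖ ≤ M) → ∀ t : ℝ, 0 ≤ t → ‖y t‖ ≤ h.var * M) := by
  have hUc : CompleteSpace U := FiniteDimensional.complete ℂ U
  have hYc : CompleteSpace Y := FiniteDimensional.complete ℂ Y
  have main : ∀ (u : ℝ → U) (x : ℝ → X) (y : ℝ → Y),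
      sys.IsClassicalSolution u x y → x 0 = 0 →
      ContDiff ℝ (⊤ : ℕ∞) u → HasCompactSupport u → tsupport u ⊆ Set.Ioi 0 →
      (∀ t : ℝ, 0 ≤ t → y t = h.conv u t) ∧
      (∀ M : ℝ, (∀ s : ℝ, ‖u s‖ ≤ M) → ∀ t : ℝ, 0 ≤ t → ‖y t‖ ≤ h.var * M) := by
    intro u x y hsol hx0 hu hc hs
    have h1 := aux_eq_conv sys h hG u x y hsol hx0 hu.continuous hc hs
    refine ⟨h1, fun M hM t ht => ?_⟩
    rw [h1 t ht]
    exact aux_conv_bound h u hs M hM t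
  have hvar : 0 ≤ h.var := ENNReal.toReal_nonneg
  refine ⟨⟨h.var + 1, by linarith, ?_⟩, main⟩
  intro u x y hsol hx0 hu hc hs M hM t ht
  have h2 := (main u x y hsol hx0 hu hc hs).2 M hM t ht
  have h3 : 0 ≤ M := (norm_nonneg _).trans (hM 0)
  linarith
end
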